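/- If there is an integer k ≥ 1 such that Σ_{j=1}^{k+1} |v_{2j-1+p_n}(δ)| > 0 for all δ ∈ D, then there exists a neighborhood U of the origin such that, for every δ ∈ D, system (1.9) has at most k limit cycles contained in U. -/

import Mathlib

open Set Filter Metric

/-- A periodic orbit of system (1.9) (for the parameter value `δ`): the image of a
nonconstant periodic solution. -/
def IsPeriodicOrbit19 (mp : ℕ) (XX YY : ℝ → ℝ → (Fin mp → ℝ) → ℝ)
    (δ : Fin mp → ℝ) (Γ : Set (ℝ × ℝ)) : Prop :=
  ∃ (γ : ℝ → ℝ × ℝ) (T : ℝ), 0 < T ∧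
    (∀ t : ℝ,
      HasDerivAt (fun s => (γ s).1) ((γ t).2 + XX (γ t).1 (γ t).2 δ) t ∧
      HasDerivAt (fun s => (γ s).2) (YY (γ t).1 (γ t).2 δ) t) ∧
    Function.Periodic γ T ∧ (∃ t, γ t ≠ γ 0) ∧ Γ = Set.range γ


/-- A limit cycle of system (1.9): an isolated periodic orbit. -/
def IsLimitCycle19 (mp : ℕ) (XX YY : ℝ → ℝ → (Fin mp → ℝ) → ℝ)
    (δ : Fin mp → ℝ) (Γ : Set (ℝ × ℝ)) : Prop :=
  IsPeriodicOrbit19 mp XX YY δ Γ ∧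
  ∃ U : Set (ℝ × ℝ), IsOpen U ∧ Γ ⊆ U ∧
    ∀ Γ' : Set (ℝ × ℝ), IsPeriodicOrbit19 mp XX YY δ Γ' → Γ' ⊆ U → Γ' = Γ

/-- `p_n = (1 + (-1)ⁿ)/2`: equal to `1` for `n` even and `0` for `n` odd. -/
def pnVal (n : ℕ) : ℕ := if Even n then 1 else 0

/-- Composition with a function analytic at `z` is an analytic operator near the constant map
`z`. -/
lemma AnalyticAt.exists_continuousMap_comp {K E F : Type*} [TopologicalSpace K] [CompactSpace K]
    [NormedAddCommGroup E] [NormedSpace ℝ E] [NormedAddCommGroup F] [NormedSpace ℝ F]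
    [CompleteSpace F] {V : E → F} {z : E} (hV : AnalyticAt ℝ V z) :
    ∃ N : C(K, E) → C(K, F), AnalyticAt ℝ N (ContinuousMap.const K z) ∧
      ∀ᶠ φ in nhds (ContinuousMap.const K z), ∀ s, N φ s = V (φ s) := by
  obtain ⟨p, r, hp⟩ := hV
  let P : FormalMultilinearSeries ℝ C(K, E) C(K, F) := fun m =>
    MultilinearMap.mkContinuous
      { toFun := fun φ => ⟨fun s => p m (fun i => φ i s), by fun_prop⟩
        map_update_add' := by
          intro _ φ i x y
          ext s
          have h : ∀ x : C(K, E), (fun j => Function.update φ i x j s)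
            = Function.update (fun j => φ j s) i (x s) := by
              intro x; funext j; rw [Function.apply_update (fun _ (f : C(K, E)) => f s)]
          simp [h]
        map_update_smul' := by
          intro _ φ i c x
          ext s
          have h : ∀ x : C(K, E), (fun j => Function.update φ i x j s)
            = Function.update (fun j => φ j s) i (x s) := by
              intro x; funext j; rw [Function.apply_update (fun _ (f : C(K, E)) => f s)]
          simp [h] } ‖p m‖ (by
        intro φ
        refine (ContinuousMap.norm_le _ (by positivity)).2 fun s => ?_
        refine ((p m).le_opNorm _).trans ?_
        gcongr with i
        exact (φ i).norm_coe_le_norm s)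
  have hPn : ∀ m, ‖P m‖ ≤ ‖p m‖ := fun m => MultilinearMap.mkContinuous_norm_le _ (norm_nonneg _) _
  have hPr : p.radius ≤ P.radius := by
    refine ENNReal.le_of_forall_nnreal_lt fun ρ hρ => ?_
    obtain ⟨C, -, hC⟩ := p.norm_mul_pow_le_of_lt_radius hρ
    exact P.le_radius_of_bound C fun m => le_trans (by gcongr; exact hPn m) (hC m)
  have hr0 : 0 < P.radius := lt_of_lt_of_le (hp.r_pos.trans_le hp.r_le) hPr
  have hPb := P.hasFPowerSeriesOnBall hr0
  refine ⟨fun φ => P.sum (φ - ContinuousMap.const K z), ?_, ?_⟩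
  · have h0 : AnalyticAt ℝ P.sum (ContinuousMap.const K z - ContinuousMap.const K z) := by
      rw [sub_self]; exact hPb.analyticAt
    exact AnalyticAt.comp (f := fun φ => φ - ContinuousMap.const K z) h0 (by fun_prop)
  · have hball : Metric.eball (ContinuousMap.const K z) r ∈ nhds (ContinuousMap.const K z) :=
      Metric.eball_mem_nhds _ hp.r_pos
    filter_upwards [hball] with φ hφ s
    have hψ : φ - ContinuousMap.const K z ∈ Metric.eball (0 : C(K, E)) r := by
      simpa [Metric.mem_eball, edist_eq_enorm_sub] using hφ
    have h1 := hPb.hasSum (Metric.eball_subset_eball (hp.r_le.trans hPr) hψ)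
    have h2 := h1.mapL (ContinuousMap.evalCLM ℝ s)
    have hs : φ s - z ∈ Metric.eball (0 : E) r := by
      rw [Metric.mem_eball, edist_zero_right] at hψ ⊢
      refine lt_of_le_of_lt ?_ hψ
      rw [← ofReal_norm, ← ofReal_norm]
      exact ENNReal.ofReal_le_ofReal ((φ - ContinuousMap.const K z).norm_coe_le_norm s)
    have h3 := hp.hasSum hs
    rw [add_sub_cancel] at h3
    rw [zero_add] at h2
    exact h2.unique h3

lemma exists_analyticAt_fixedPoint {P A : Type*} [NormedAddCommGroup P] [NormedSpace ℝ P]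
    [CompleteSpace P] [NormedAddCommGroup A] [NormedSpace ℝ A] [CompleteSpace A] {T : P × A → A} {μ : P} {w : A}
    (hT : AnalyticAt ℝ T (μ, w)) (hTw : T (μ, w) = w)
    (hD : (fderiv ℝ T (μ, w)).comp (ContinuousLinearMap.inr ℝ P A) = 0) :
    ∃ W : P → A, AnalyticAt ℝ W μ ∧ W μ = w ∧ (∀ᶠ ν in nhds μ, T (ν, W ν) = W ν) ∧
      ∀ᶠ q in nhds (μ, w), T q = q.2 → q.2 = W q.1 := by
  let Ξ : P × A → P × A := fun q => (q.1, q.2 - T q)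
  have hΞ : AnalyticAt ℝ Ξ (μ, w) := analyticAt_fst.prod (analyticAt_snd.sub hT)
  set D := fderiv ℝ T (μ, w) with hDdef
  have hD' : ∀ q : P × A, D q = D (q.1, 0) := by
    intro q
    have h0 : D (0, q.2) = 0 := by simpa using DFunLike.congr_fun hD q.2
    have : q = (q.1, 0) + (0, q.2) := by simp
    conv_lhs => rw [this, map_add, h0, add_zero]
  let e : (P × A) ≃L[ℝ] (P × A) := ContinuousLinearEquiv.equivOfInverse
    ((ContinuousLinearMap.fst ℝ P A).prod (ContinuousLinearMap.snd ℝ P A - D))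
    ((ContinuousLinearMap.fst ℝ P A).prod (ContinuousLinearMap.snd ℝ P A + D))
    (by intro q; ext <;> simp [hD' (_, _)])
    (by intro q; ext <;> simp [hD' (_, _)])
  have hder : HasStrictFDerivAt Ξ (e : P × A →L[ℝ] P × A) (μ, w) := by
    have := hT.hasStrictFDerivAt
    exact (hasStrictFDerivAt_fst).prodMk (hasStrictFDerivAt_snd.sub this)
  have hΞ0 : Ξ (μ, w) = (μ, 0) := by simp [Ξ, hTw]
  let f := hder.toOpenPartialHomeomorph Ξ
  have hfs : (μ, w) ∈ f.source := hder.mem_toOpenPartialHomeomorph_source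
  have hft : (μ, (0 : A)) ∈ f.target := hΞ0 ▸ hder.image_mem_toOpenPartialHomeomorph_target
  have hsymm : f.symm (μ, 0) = (μ, w) := by
    rw [← hΞ0]; exact f.left_inv hfs
  have han : AnalyticAt ℝ f.symm (μ, 0) := by
    rw [← hΞ0]
    exact f.analyticAt_symm' (i := e) hfs hΞ (hder.hasFDerivAt.fderiv)
  have hemb : ContinuousAt (fun ν : P => (ν, (0 : A))) μ := by fun_prop
  refine ⟨fun ν => (f.symm (ν, 0)).2, ?_, by simp [hsymm], ?_, ?_⟩
  · exact analyticAt_snd.comp (AnalyticAt.comp (f := fun ν : P => (ν, (0 : A))) han (by fun_prop))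
  · filter_upwards [hemb.eventually (f.open_target.mem_nhds hft)] with ν hν
    have h1 : Ξ (f.symm (ν, 0)) = (ν, 0) := f.right_inv hν
    have h2 : (f.symm (ν, 0)).1 = ν := congrArg Prod.fst h1
    have h3 : (f.symm (ν, 0)).2 - T (f.symm (ν, 0)) = 0 := congrArg Prod.snd h1
    have h4 : (ν, (f.symm (ν, 0)).2) = f.symm (ν, 0) := by ext <;> simp [h2]
    rw [h4]; exact (sub_eq_zero.1 h3).symm
  · filter_upwards [f.open_source.mem_nhds hfs] with q hq hTq
    have h1 : Ξ q = (q.1, 0) := by simp [Ξ, hTq]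
    have h2 : f.symm (Ξ q) = q := f.left_inv hq
    rw [← h1, h2]

/-- The Volterra operator `φ ↦ (s ↦ ∫₀ˢ φ)` on continuous functions on `[0, L]`. -/
noncomputable def volterra (L : ℝ) (hL : 0 ≤ L) : C(Icc 0 L, ℝ) →L[ℝ] C(Icc 0 L, ℝ) :=
  LinearMap.mkContinuous
    { toFun := fun φ => ⟨fun s => ∫ t in (0 : ℝ)..s, IccExtend hL φ t, by
        have h : Continuous fun x : ℝ => ∫ t in (0 : ℝ)..x, IccExtend hL φ t :=
          intervalIntegral.continuous_primitive
            (fun a b => (φ.continuous.Icc_extend' (h := hL)).intervalIntegrable a b) 0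
        exact h.comp continuous_subtype_val⟩
      map_add' := by
        intro φ ψ
        ext s
        exact intervalIntegral.integral_add
          ((φ.continuous.Icc_extend' (h := hL)).intervalIntegrable _ _)
          ((ψ.continuous.Icc_extend' (h := hL)).intervalIntegrable _ _)
      map_smul' := by
        intro c φ
        ext s
        exact intervalIntegral.integral_const_mul c _ } L (by
    intro φ
    refine (ContinuousMap.norm_le _ (by positivity)).2 fun s => ?_
    have h := intervalIntegral.norm_integral_le_of_norm_le_const (a := 0) (b := (s : ℝ)) (C := ‖φ‖)
      (f := IccExtend hL φ) (fun x _ => φ.norm_coe_le_norm _)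
    refine h.trans ?_
    rw [mul_comm, sub_zero, abs_of_nonneg s.2.1]
    gcongr
    exact s.2.2)

lemma volterra_apply {L : ℝ} (hL : 0 ≤ L) (φ : C(Icc 0 L, ℝ)) (s : Icc 0 L) :
    volterra L hL φ s = ∫ t in (0 : ℝ)..s, IccExtend hL φ t := rfl

section Division

variable {Λ : Type*} [NormedAddCommGroup Λ] [NormedSpace ℝ Λ]

lemma AnalyticAt.hasDerivAt_slice {G : ℝ × Λ → ℝ} {x : ℝ} {l : Λ} (hG : AnalyticAt ℝ G (x, l)) :
    HasDerivAt (fun y => G (y, l)) (fderiv ℝ G (x, l) (1, 0)) x := by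
  have h1 : HasDerivAt (fun y : ℝ => (y, l)) (1, 0) x :=
    (hasDerivAt_id x).prodMk (hasDerivAt_const x l)
  exact hG.differentiableAt.hasFDerivAt.comp_hasDerivAt x h1

lemma AnalyticAt.slice {G : ℝ × Λ → ℝ} {x : ℝ} {l : Λ} (hG : AnalyticAt ℝ G (x, l)) :
    AnalyticAt ℝ (fun y => G (y, l)) x :=
  AnalyticAt.comp (f := fun y : ℝ => (y, l)) hG (by fun_prop)

lemma AnalyticAt.fderiv_apply {E F : Type*} [NormedAddCommGroup E] [NormedSpace ℝ E]
    [NormedAddCommGroup F] [NormedSpace ℝ F] [CompleteSpace F] {G : E → F} {x : E}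
    (hG : AnalyticAt ℝ G x) (e : E) : AnalyticAt ℝ (fun y => fderiv ℝ G y e) x :=
  ((ContinuousLinearMap.apply ℝ F e).analyticAt _).comp hG.fderiv

lemma AnalyticAt.partial_deriv {G : ℝ × Λ → ℝ} {x : ℝ} {l : Λ} (hG : AnalyticAt ℝ G (x, l)) :
    AnalyticAt ℝ (fun q : ℝ × Λ => deriv (fun y => G (y, q.2)) q.1) (x, l) := by
  refine (hG.fderiv_apply (1, 0)).congr ?_
  filter_upwards [hG.eventually_analyticAt] with q hq
  exact (AnalyticAt.hasDerivAt_slice (x := q.1) (l := q.2) hq).deriv.symm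

lemma AnalyticAt.partial_iteratedDeriv {G : ℝ × Λ → ℝ} {x : ℝ} {l : Λ}
    (hG : AnalyticAt ℝ G (x, l)) (m : ℕ) :
    AnalyticAt ℝ (fun q : ℝ × Λ => iteratedDeriv m (fun y => G (y, q.2)) q.1) (x, l) := by
  induction m with
  | zero => simpa using hG
  | succ m ih => simpa only [iteratedDeriv_succ] using ih.partial_deriv

/-- Hadamard's lemma for analytic functions with parameters. -/
lemma AnalyticAt.exists_hadamard {G : ℝ × Λ → ℝ} {l : Λ} (hG : AnalyticAt ℝ G (0, l)) :
    ∃ H : ℝ × Λ → ℝ, AnalyticAt ℝ H (0, l) ∧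
      ∀ᶠ q in nhds ((0 : ℝ), l), G q = G (0, q.2) + q.1 * H q := by
  obtain ⟨N, hN, hNe⟩ := (hG.fderiv_apply (1, 0)).exists_continuousMap_comp (K := Icc (0 : ℝ) 1)
  let ι : C(Icc (0 : ℝ) 1, ℝ) := ⟨Subtype.val, continuous_subtype_val⟩
  let A : ℝ × Λ → C(Icc (0 : ℝ) 1, ℝ × Λ) := fun q =>
    (ContinuousLinearMap.inl ℝ ℝ Λ).compLeftContinuous ℝ _ (q.1 • ι)
      + ContinuousLinearMap.const ℝ (Icc (0 : ℝ) 1) (0, q.2)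
  have hA : ∀ q s, A q s = (q.1 * (s : ℝ), q.2) := by
    intro q s
    simp [A, ι]
  have hA0 : A (0, l) = ContinuousMap.const _ (0, l) := by
    ext s <;> simp [hA]
  have hAan : ∀ q, AnalyticAt ℝ A q := by
    intro q
    refine AnalyticAt.add ?_ ?_
    · exact (ContinuousLinearMap.analyticAt _ _).comp (analyticAt_fst.smul analyticAt_const)
    · exact (ContinuousLinearMap.analyticAt _ _).comp (analyticAt_const.prod analyticAt_snd)
  have hNA : AnalyticAt ℝ (fun q => N (A q)) (0, l) := AnalyticAt.comp (by rwa [hA0]) (hAan _)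
  let one : Icc (0 : ℝ) 1 := ⟨1, by simp⟩
  refine ⟨fun q => volterra 1 zero_le_one (N (A q)) one, ?_, ?_⟩
  · exact ((ContinuousMap.evalCLM ℝ one).analyticAt _).comp
      (((volterra 1 zero_le_one).analyticAt _).comp hNA)
  · have hAc : Tendsto A (nhds (0, l)) (nhds (ContinuousMap.const _ (0, l))) := by
      rw [← hA0]; exact (hAan _).continuousAt
    obtain ⟨ε, hε, hball⟩ := Metric.eventually_nhds_iff_ball.1 hG.eventually_analyticAt
    filter_upwards [hAc.eventually hNe, Metric.ball_mem_nhds ((0 : ℝ), l) hε] with q hq hqb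
    have hmem : ∀ s ∈ Icc (0 : ℝ) 1, AnalyticAt ℝ G (s * q.1, q.2) := by
      intro s hs
      apply hball
      rw [Metric.mem_ball, Prod.dist_eq, max_lt_iff] at hqb ⊢
      refine ⟨?_, hqb.2⟩
      rw [Real.dist_eq, sub_zero] at hqb ⊢
      rw [abs_mul, abs_of_nonneg hs.1]
      exact lt_of_le_of_lt (mul_le_of_le_one_left (abs_nonneg _) hs.2) hqb.1
    have hder : ∀ s ∈ uIcc (0 : ℝ) 1, HasDerivAt (fun s => G (s * q.1, q.2))
        (q.1 * fderiv ℝ G (s * q.1, q.2) (1, 0)) s := by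
      intro s hs
      rw [uIcc_of_le zero_le_one] at hs
      have h1 := (hmem s hs).hasDerivAt_slice
      have h2 : HasDerivAt (fun s : ℝ => s * q.1) q.1 s := by
        simpa using (hasDerivAt_id s).mul_const q.1
      have h3 := HasDerivAt.comp s h1 h2
      rw [mul_comm] at h3
      exact h3
    have hval : ∀ s ∈ uIcc (0 : ℝ) 1, IccExtend zero_le_one (N (A q)) s
        = fderiv ℝ G (s * q.1, q.2) (1, 0) := by
      intro s hs
      rw [uIcc_of_le zero_le_one] at hs
      rw [IccExtend_of_mem _ _ hs, hq, hA, mul_comm]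
    have hftc := intervalIntegral.integral_eq_sub_of_hasDerivAt hder (by
      apply ContinuousOn.intervalIntegrable
      have hc : ContinuousOn (fun s => q.1 * IccExtend zero_le_one (N (A q)) s) (uIcc (0 : ℝ) 1) :=
        ((N (A q)).continuous.Icc_extend'.const_mul q.1 |>.continuousOn)
      exact hc.congr fun s hs => by simp only [hval s hs])
    rw [volterra_apply, intervalIntegral.integral_congr hval, ← intervalIntegral.integral_const_mul]
    rw [hftc]
    simp

/-- Division of an analytic function by `xᴺ`, uniformly in parameters for which it is possible. -/
lemma AnalyticAt.exists_div_pow {G : ℝ × Λ → ℝ} {l : Λ} (hG : AnalyticAt ℝ G (0, l)) (N : ℕ) :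
    ∃ H : ℝ × Λ → ℝ, AnalyticAt ℝ H (0, l) ∧
      ∃ ε > 0, ∀ l' ∈ ball l ε, ∀ u : ℝ → ℝ, ContinuousAt u 0 →
        (∀ᶠ x in nhds 0, G (x, l') = x ^ N * u x) →
        H (0, l') = u 0 ∧ ∀ x : ℝ, |x| < ε → G (x, l') = x ^ N * H (x, l') := by
  induction N generalizing G with
  | zero =>
    refine ⟨G, hG, 1, one_pos, fun l' _ u _ h => ⟨?_, by simp⟩⟩
    simpa using h.self_of_nhds
  | succ N ih =>
    obtain ⟨H₁, hH₁, hGH⟩ := hG.exists_hadamard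
    obtain ⟨H, hH, ε, hε, hu⟩ := ih hH₁
    obtain ⟨η, hη, hball⟩ := Metric.eventually_nhds_iff_ball.1 (hGH.and hH₁.eventually_analyticAt)
    refine ⟨H, hH, min ε η, lt_min hε hη, fun l' hl' u huc hev => ?_⟩
    have hG0 : G (0, l') = 0 := by simpa using hev.self_of_nhds
    have hb : ∀ x : ℝ, |x| < η → G (x, l') = x * H₁ (x, l') ∧ AnalyticAt ℝ H₁ (x, l') := by
      intro x hx
      have := hball (x, l') (by
        rw [Metric.mem_ball, Prod.dist_eq, max_lt_iff]
        exact ⟨by simpa [Real.dist_eq] using hx, ball_subset_ball (min_le_right _ _) hl'⟩)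
      rw [hG0, zero_add] at this
      exact this
    have hne : ∀ᶠ x in nhdsWithin (0 : ℝ) {0}ᶜ, H₁ (x, l') = x ^ N * u x := by
      have hη' : ∀ᶠ x : ℝ in nhds 0, |x| < η := by
        filter_upwards [Metric.ball_mem_nhds (0 : ℝ) hη] with x hx
        simpa using hx
      filter_upwards [nhdsWithin_le_nhds hev, nhdsWithin_le_nhds hη', self_mem_nhdsWithin]
        with x hx hxη hx0
      rw [(hb x hxη).1, pow_succ', mul_assoc] at hx
      exact mul_left_cancel₀ hx0 hx
    have hc : ContinuousAt (fun x => H₁ (x, l')) 0 := (hb 0 (by simpa using hη)).2.slice.continuousAt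
    have hev' : ∀ᶠ x in nhds 0, H₁ (x, l') = x ^ N * u x := by
      have h0 : H₁ (0, l') = 0 ^ N * u 0 := by
        refine tendsto_nhds_unique (hc.tendsto.mono_left nhdsWithin_le_nhds)
          (Tendsto.congr' (EventuallyEq.symm hne) ?_)
        exact (((continuousAt_id (x := (0 : ℝ))).pow N).mul huc).tendsto.mono_left nhdsWithin_le_nhds
      rw [← nhdsNE_sup_pure]
      exact eventually_sup.2 ⟨hne, by simpa using h0⟩
    obtain ⟨h1, h2⟩ := hu l' (ball_subset_ball (min_le_left _ _) hl') u huc hev'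
    refine ⟨h1, fun x hx => ?_⟩
    rw [(hb x (hx.trans_le (min_le_right _ _))).1, h2 x (hx.trans_le (min_le_left _ _)), pow_succ',
      mul_assoc]

end Division

section Uniqueness

variable {E : Type*} [NormedAddCommGroup E] [NormedSpace ℝ E] {v : E → E} {σ : ℝ → ℝ}
  {f g : ℝ → E} {a b : ℝ}

/-- Forward uniqueness for `z' = σ(t) v(z)`, with `v` locally Lipschitz along one solution. -/
lemma eqOn_Icc_of_hasDerivAt_smul_left (hσ : ContinuousOn σ (Icc a b))
    (hf : ∀ t ∈ Icc a b, HasDerivAt f (σ t • v (f t)) t)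
    (hg : ∀ t ∈ Icc a b, HasDerivAt g (σ t • v (g t)) t)
    (hv : ∀ t ∈ Icc a b, ∃ K, ∃ s ∈ nhds (g t), LipschitzOnWith K v s)
    (hab : f a = g a) : EqOn f g (Icc a b) := by
  have hfc : ContinuousOn f (Icc a b) := fun t ht => (hf t ht).continuousAt.continuousWithinAt
  have hgc : ContinuousOn g (Icc a b) := fun t ht => (hg t ht).continuousAt.continuousWithinAt
  have hclosed : IsClosed ({t | f t = g t} ∩ Icc a b) := by
    have := (hfc.sub hgc).preimage_isClosed_of_isClosed isClosed_Icc (isClosed_singleton (x := (0 : E)))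
    convert this using 1
    ext t; simp [sub_eq_zero, and_comm]
  refine hclosed.Icc_subset_of_forall_exists_gt hab ?_
  rintro x ⟨hx : f x = g x, hxab⟩ y hxy
  have hxI : x ∈ Icc a b := Ico_subset_Icc_self hxab
  obtain ⟨K, s, hs, hK⟩ := hv x hxI
  obtain ⟨C, hC⟩ := (isCompact_Icc (a := a) (b := b)).exists_bound_of_continuousOn hσ
  have h1 := (hf x hxI).continuousAt.eventually_mem (by rwa [hx])
  have h2 := (hg x hxI).continuousAt.eventually_mem hs
  obtain ⟨ε, hε, hball⟩ := Metric.eventually_nhds_iff_ball.1 (h1.and h2)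
  obtain ⟨z, hxz, hz⟩ : ∃ z, x < z ∧ z ≤ y ∧ z ≤ b ∧ z < x + ε := by
    obtain ⟨z, hz1, hz2⟩ := exists_between (lt_min (lt_min (mem_Ioi.1 hxy) hxab.2) (by linarith : x < x + ε))
    rw [lt_min_iff, lt_min_iff] at hz2
    exact ⟨z, hz1, hz2.1.1.le, hz2.1.2.le, hz2.2⟩
  have hsub : Icc x z ⊆ Icc a b := Icc_subset_Icc hxab.1 hz.2.1
  have hin : ∀ t ∈ Icc x z, t ∈ ball x ε := by
    intro t ht
    rw [Real.ball_eq_Ioo]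
    exact ⟨by linarith [ht.1], lt_of_le_of_lt ht.2 hz.2.2⟩
  have key := ODE_solution_unique_of_mem_Icc_right (v := fun t p => σ t • v p) (s := fun _ => s)
    (K := C.toNNReal * K) (f := f) (g := g) (a := x) (b := z)
    (fun t ht => by
      refine LipschitzOnWith.of_dist_le_mul fun p hp q hq => ?_
      rw [dist_smul₀]
      push_cast
      rw [mul_assoc]
      gcongr
      · exact (hC t (hsub (Ico_subset_Icc_self ht))).trans (Real.le_coe_toNNReal C)
      · exact hK.dist_le_mul p hp q hq)
    (hfc.mono hsub) (fun t ht => (hf t (hsub (Ico_subset_Icc_self ht))).hasDerivWithinAt)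
    (fun t ht => (hball t (hin t (Ico_subset_Icc_self ht))).1)
    (hgc.mono hsub) (fun t ht => (hg t (hsub (Ico_subset_Icc_self ht))).hasDerivWithinAt)
    (fun t ht => (hball t (hin t (Ico_subset_Icc_self ht))).2) hx
  exact ⟨z, key ⟨hxz.le, le_rfl⟩, hxz, hz.1⟩

/-- Uniqueness for `z' = σ(t) v(z)`, with `v` locally Lipschitz along one of the solutions. -/
lemma eqOn_Icc_of_hasDerivAt_smul {t₀ : ℝ} (hσ : ContinuousOn σ (Icc a b))
    (hf : ∀ t ∈ Icc a b, HasDerivAt f (σ t • v (f t)) t)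
    (hg : ∀ t ∈ Icc a b, HasDerivAt g (σ t • v (g t)) t)
    (hv : ∀ t ∈ Icc a b, ∃ K, ∃ s ∈ nhds (g t), LipschitzOnWith K v s)
    (ht₀ : t₀ ∈ Icc a b) (heq : f t₀ = g t₀) : EqOn f g (Icc a b) := by
  intro t ht
  rcases le_total t₀ t with h | h
  · have hsub : Icc t₀ b ⊆ Icc a b := Icc_subset_Icc_left ht₀.1
    exact eqOn_Icc_of_hasDerivAt_smul_left (hσ.mono hsub) (fun t ht => hf t (hsub ht))
      (fun t ht => hg t (hsub ht)) (fun t ht => hv t (hsub ht)) heq ⟨h, ht.2⟩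
  · have hmaps : MapsTo Neg.neg (Icc (-t₀) (-a)) (Icc a b) := fun s hs =>
      ⟨by linarith [hs.2], by linarith [hs.1, ht₀.2]⟩
    have hrev : ∀ {F : ℝ → E}, (∀ t ∈ Icc a b, HasDerivAt F (σ t • v (F t)) t) →
        ∀ s ∈ Icc (-t₀) (-a), HasDerivAt (fun s => F (-s)) ((-σ (-s)) • v (F (-s))) s := by
      intro F hF s hs
      have := (hF (-s) (hmaps hs)).scomp s (hasDerivAt_neg s)
      simpa [Function.comp_def] using this
    have := eqOn_Icc_of_hasDerivAt_smul_left (v := v) (σ := fun s => -σ (-s))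
      (f := fun s => f (-s)) (g := fun s => g (-s)) (a := -t₀) (b := -a)
      ((hσ.comp continuous_neg.continuousOn hmaps).neg) (hrev hf) (hrev hg)
      (fun s hs => hv (-s) (hmaps hs)) (by simpa using heq)
      (show -t ∈ Icc (-t₀) (-a) from ⟨by linarith, by linarith [ht.1]⟩)
    simpa using this

/-- Uniqueness for an autonomous equation, with `v` locally Lipschitz along one of the solutions. -/
lemma eq_of_hasDerivAt_autonomous {t₀ : ℝ} (hf : ∀ t, HasDerivAt f (v (f t)) t)
    (hg : ∀ t, HasDerivAt g (v (g t)) t)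
    (hv : ∀ t, ∃ K, ∃ s ∈ nhds (g t), LipschitzOnWith K v s) (heq : f t₀ = g t₀) : f = g := by
  funext t
  refine eqOn_Icc_of_hasDerivAt_smul (v := v) (σ := fun _ => 1) (a := min t t₀) (b := max t t₀)
    continuousOn_const (fun t _ => by simpa using hf t) (fun t _ => by simpa using hg t)
    (fun t _ => hv t) ⟨min_le_right _ _, le_max_right _ _⟩ heq ⟨min_le_left _ _, le_max_left _ _⟩

end Uniqueness

/-- A function whose `m`-th derivative does not vanish on an interval has at most `m` zeros there. -/
lemma card_le_of_iteratedDeriv_ne_zero {a b : ℝ} (m : ℕ) {f : ℝ → ℝ}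
    (hf : ∀ x ∈ Ioo a b, AnalyticAt ℝ f x) (hm : ∀ x ∈ Ioo a b, iteratedDeriv m f x ≠ 0)
    (Z : Finset ℝ) (hZ : ∀ x ∈ Z, x ∈ Ioo a b ∧ f x = 0) : Z.card ≤ m := by
  induction m generalizing f Z with
  | zero =>
    rw [Nat.le_zero, Finset.card_eq_zero]
    refine Finset.eq_empty_of_forall_notMem fun x hx => ?_
    exact hm x (hZ x hx).1 (by simpa using (hZ x hx).2)
  | succ m ih =>
    by_contra! hcard
    let e := Z.orderEmbOfFin (k := Z.card) rfl
    have hmem : ∀ i, e i ∈ Z := fun i => Z.orderEmbOfFin_mem rfl i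
    have hrolle : ∀ i : Fin (m + 1), ∃ c,
        c ∈ Ioo (e ⟨i, by omega⟩) (e ⟨i + 1, by omega⟩) ∧ deriv f c = 0 := by
      intro i
      have hlt : e ⟨i, by omega⟩ < e ⟨i + 1, by omega⟩ := e.strictMono (by simp [Fin.lt_def])
      refine exists_deriv_eq_zero hlt ?_ ?_
      · intro x hx
        refine (hf x ⟨?_, ?_⟩).continuousAt.continuousWithinAt
        · exact (hZ _ (hmem _)).1.1.trans_le hx.1
        · exact hx.2.trans_lt (hZ _ (hmem _)).1.2
      · rw [(hZ _ (hmem _)).2, (hZ _ (hmem _)).2]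
    choose c hc hc0 using hrolle
    have hcmono : StrictMono c := by
      intro i j hij
      refine (hc i).2.trans_le (le_trans ?_ (hc j).1.le)
      exact e.monotone (by rw [Fin.le_def]; exact hij)
    have := ih (f := deriv f) (fun x hx => (hf x hx).deriv)
      (fun x hx => by simpa only [iteratedDeriv_succ'] using hm x hx) (Finset.univ.image c) (by
        intro x hx
        obtain ⟨i, -, rfl⟩ := Finset.mem_image.1 hx
        exact ⟨⟨(hZ _ (hmem _)).1.1.trans (hc i).1, (hc i).2.trans (hZ _ (hmem _)).1.2⟩, hc0 i⟩)
    rw [Finset.card_image_of_injective _ hcmono.injective] at this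
    simp at this

lemma eventually_hasDerivAt_of_hadamard {Λ : Type*} [NormedAddCommGroup Λ] [NormedSpace ℝ Λ]
    {G H : ℝ × Λ → ℝ} {l : Λ} (hH : AnalyticAt ℝ H (0, l))
    (h : ∀ᶠ q in nhds ((0 : ℝ), l), G q = G (0, q.2) + q.1 * H q) :
    ∀ᶠ l' in nhds l, HasDerivAt (fun x => G (x, l')) (H (0, l')) 0 := by
  have hemb : ContinuousAt (fun l' : Λ => ((0 : ℝ), l')) l := by fun_prop
  filter_upwards [hemb.eventually (h.eventually_nhds.and hH.eventually_analyticAt)] with l' hl'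
  have h1 : (fun x => G (x, l')) =ᶠ[nhds 0] fun x => G (0, l') + x * H (x, l') :=
    (show ContinuousAt (fun x : ℝ => (x, l')) 0 by fun_prop).eventually hl'.1
  have h2 := (((hasDerivAt_id (0 : ℝ)).mul hl'.2.hasDerivAt_slice).const_add (G (0, l')))
  refine HasDerivAt.congr_of_eventuallyEq ?_ h1
  simpa using h2

section NormalForm

variable {Λ : Type*} [NormedAddCommGroup Λ] [NormedSpace ℝ Λ] [CompleteSpace Λ]

lemma exists_implicit_graph {X : ℝ → ℝ → Λ → ℝ} {δ₀ : Λ}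
    (hX : AnalyticAt ℝ (fun p : ℝ × ℝ × Λ => X p.1 p.2.1 p.2.2) (0, 0, δ₀))
    (hX0 : X 0 0 δ₀ = 0) (hXy : HasDerivAt (fun y => X 0 y δ₀) 0 0) :
    ∃ Φ : ℝ × Λ → ℝ, AnalyticAt ℝ Φ (0, δ₀) ∧ Φ (0, δ₀) = 0 ∧
      (∀ᶠ q in nhds ((0 : ℝ), δ₀), Φ q + X q.1 (Φ q) q.2 = 0) ∧
      ∀ᶠ p in nhds ((0 : ℝ), (0 : ℝ), δ₀), p.2.1 + X p.1 p.2.1 p.2.2 = 0 → p.2.1 = Φ (p.1, p.2.2) := by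
  let T : (ℝ × Λ) × ℝ → ℝ := fun q => -X q.1.1 q.2 q.1.2
  have hT : AnalyticAt ℝ T ((0, δ₀), 0) := by
    have := AnalyticAt.comp (f := fun q : (ℝ × Λ) × ℝ => (q.1.1, q.2, q.1.2)) (x := ((0, δ₀), 0)) hX
      ((analyticAt_fst.comp analyticAt_fst).prod
        (analyticAt_snd.prod (analyticAt_snd.comp analyticAt_fst)))
    exact this.neg
  have hD : (fderiv ℝ T ((0, δ₀), 0)).comp (ContinuousLinearMap.inr ℝ (ℝ × Λ) ℝ) = 0 := by
    have h1 : HasDerivAt (fun y : ℝ => (((0 : ℝ), δ₀), y)) ((0 : ℝ × Λ), (1 : ℝ)) 0 :=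
      (hasDerivAt_const _ _).prodMk (hasDerivAt_id _)
    have h2 := hT.differentiableAt.hasFDerivAt.comp_hasDerivAt (0 : ℝ) h1
    have h3 : HasDerivAt (T ∘ fun y : ℝ => (((0 : ℝ), δ₀), y)) (-0) 0 := hXy.neg
    ext
    simpa using h2.unique h3
  obtain ⟨Φ, hΦ, hΦ0, hΦe, hΦu⟩ := exists_analyticAt_fixedPoint hT (by simp [T, hX0]) hD
  refine ⟨Φ, hΦ, hΦ0, ?_, ?_⟩
  · filter_upwards [hΦe] with q hq
    have : -X q.1 (Φ q) q.2 = Φ q := hq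
    linarith
  · have hc : Tendsto (fun p : ℝ × ℝ × Λ => ((p.1, p.2.2), p.2.1)) (nhds (0, 0, δ₀))
        (nhds ((0, δ₀), 0)) := by
      apply Continuous.tendsto' (by fun_prop); rfl
    filter_upwards [hc.eventually hΦu] with p hp h
    exact hp (show -X p.1 p.2.1 p.2.2 = p.2.1 by linarith)

/-- The normal form of the system in the coordinates `(v, x)`, `v = y - Φ(x, δ)`, near `δ₀`. -/
structure NormalForm (D : Set Λ) (X Y : ℝ → ℝ → Λ → ℝ) (n : ℕ) (a b : Λ → ℝ) (δ₀ : Λ) where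
  Φ : ℝ × Λ → ℝ
  M : ℝ × ℝ × Λ → ℝ
  h : ℝ × ℝ × Λ → ℝ
  g₀ : ℝ × Λ → ℝ
  g₁ : ℝ × Λ → ℝ
  ε : ℝ
  ε_pos : 0 < ε
  analyticAt_M : AnalyticAt ℝ M (0, 0, δ₀)
  analyticAt_h : AnalyticAt ℝ h (0, 0, δ₀)
  analyticAt_g₀ : AnalyticAt ℝ g₀ (0, δ₀)
  analyticAt_g₁ : AnalyticAt ℝ g₁ (0, δ₀)
  analyticAt_Φ : ∀ x δ, |x| < ε → δ ∈ ball δ₀ ε → AnalyticAt ℝ Φ (x, δ)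
  analyticAt_X : ∀ x y δ, |x| < ε → |y| < ε → δ ∈ ball δ₀ ε →
    AnalyticAt ℝ (fun p : ℝ × ℝ × Λ => X p.1 p.2.1 p.2.2) (x, y, δ)
  analyticAt_Y : ∀ x y δ, |x| < ε → |y| < ε → δ ∈ ball δ₀ ε →
    AnalyticAt ℝ (fun p : ℝ × ℝ × Λ => Y p.1 p.2.1 p.2.2) (x, y, δ)
  M_zero : M (0, 0, δ₀) = 1
  g₀_zero : ∀ δ ∈ D ∩ ball δ₀ ε, g₀ (0, δ) = -a δ
  g₁_zero : ∀ δ ∈ D ∩ ball δ₀ ε, g₁ (0, δ) = -b δ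
  Φ_zero : ∀ δ ∈ D ∩ ball δ₀ ε, Φ (0, δ) = 0
  eq_Φ : ∀ x y δ, |x| < ε → |y| < ε → δ ∈ ball δ₀ ε → y + X x y δ = 0 → y = Φ (x, δ)
  x_eq : ∀ x v δ, |x| < ε → |v| < ε → δ ∈ ball δ₀ ε →
    Φ (x, δ) + v + X x (Φ (x, δ) + v) δ = v * M (v, x, δ)
  v_eq : ∀ x v δ, |x| < ε → |v| < ε → δ ∈ D ∩ ball δ₀ ε →
    Y x (Φ (x, δ) + v) δ = deriv (fun s => Φ (s, δ)) x * (v * M (v, x, δ)) +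
      x ^ (2 * n - 1) * g₀ (x, δ) + v * x ^ (n - 1) * g₁ (x, δ) + v ^ 2 * h (v, x, δ)

lemma exists_normalForm {D : Set Λ} {X Y : ℝ → ℝ → Λ → ℝ} {n : ℕ} {a b : Λ → ℝ} {δ₀ : Λ}
    (hδ₀ : δ₀ ∈ D)
    (hX : AnalyticAt ℝ (fun p : ℝ × ℝ × Λ => X p.1 p.2.1 p.2.2) (0, 0, δ₀))
    (hY : AnalyticAt ℝ (fun p : ℝ × ℝ × Λ => Y p.1 p.2.1 p.2.2) (0, 0, δ₀))
    (hX0 : ∀ δ ∈ D, X 0 0 δ = 0) (hXy : HasDerivAt (fun y => X 0 y δ₀) 0 0)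
    (F : ℝ → Λ → ℝ) (hFc : ∀ δ ∈ D, ContinuousAt (fun x => F x δ) 0)
    (hF0 : ∀ δ ∈ D, F 0 δ = 0)
    (hFsol : ∀ δ ∈ D, ∀ᶠ x in nhds (0 : ℝ), F x δ + X x (F x δ) δ = 0)
    (hg : ∀ δ ∈ D, ∃ u : ℝ → ℝ, ContinuousAt u 0 ∧ u 0 = a δ ∧
      ∀ᶠ x in nhds (0 : ℝ), -Y x (F x δ) δ = x ^ (2 * n - 1) * u x)
    (hf : ∀ δ ∈ D, ∃ w : ℝ → ℝ, ContinuousAt w 0 ∧ w 0 = b δ ∧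
      ∀ᶠ x in nhds (0 : ℝ), -(deriv (fun s => X s (F x δ) δ) x + deriv (fun s => Y x s δ) (F x δ))
        = x ^ (n - 1) * w x) :
    Nonempty (NormalForm D X Y n a b δ₀) := by
  obtain ⟨Φ, hΦ, hΦ0, hΦe, hΦu⟩ := exists_implicit_graph hX (hX0 δ₀ hδ₀) hXy
  have hΦ' : AnalyticAt ℝ (fun q : ℝ × ℝ × Λ => Φ q.2) (0, 0, δ₀) :=
    AnalyticAt.comp (f := fun q : ℝ × ℝ × Λ => q.2) hΦ analyticAt_snd
  have hpt : AnalyticAt ℝ (fun q : ℝ × ℝ × Λ => (q.2.1, Φ q.2 + q.1, q.2.2)) (0, 0, δ₀) :=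
    (analyticAt_fst.comp analyticAt_snd).prod
      ((hΦ'.add analyticAt_fst).prod (analyticAt_snd.comp analyticAt_snd))
  let K : ℝ × ℝ × Λ → ℝ := fun q => Φ q.2 + q.1 + X q.2.1 (Φ q.2 + q.1) q.2.2
  have hK : AnalyticAt ℝ K (0, 0, δ₀) := by
    refine (hΦ'.add analyticAt_fst).add ?_
    exact AnalyticAt.comp (g := fun p : ℝ × ℝ × Λ => X p.1 p.2.1 p.2.2)
      (by simpa [hΦ0] using hX) hpt
  let G : ℝ × ℝ × Λ → ℝ := fun q =>
    Y q.2.1 (Φ q.2 + q.1) q.2.2 - deriv (fun s => Φ (s, q.2.2)) q.2.1 * K q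
  have hG : AnalyticAt ℝ G (0, 0, δ₀) := by
    refine AnalyticAt.sub ?_ (AnalyticAt.mul ?_ hK)
    · exact AnalyticAt.comp (g := fun p : ℝ × ℝ × Λ => Y p.1 p.2.1 p.2.2)
        (by simpa [hΦ0] using hY) hpt
    · exact AnalyticAt.comp (g := fun q : ℝ × Λ => deriv (fun s => Φ (s, q.2)) q.1)
        (f := fun q : ℝ × ℝ × Λ => q.2) hΦ.partial_deriv analyticAt_snd
  obtain ⟨M, hM, hKM⟩ := hK.exists_hadamard
  obtain ⟨H, hH, hGH⟩ := hG.exists_hadamard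
  obtain ⟨h, hh, hHh⟩ := hH.exists_hadamard
  have hKd := eventually_hasDerivAt_of_hadamard hM hKM
  have hGd := eventually_hasDerivAt_of_hadamard hH hGH
  have hemb : AnalyticAt ℝ (fun q : ℝ × Λ => ((0 : ℝ), q)) (0, δ₀) := by fun_prop
  have hG0 : AnalyticAt ℝ (fun q : ℝ × Λ => G (0, q)) (0, δ₀) :=
    AnalyticAt.comp (g := G) hG hemb
  have hH0 : AnalyticAt ℝ (fun q : ℝ × Λ => H (0, q)) (0, δ₀) :=
    AnalyticAt.comp (g := H) hH hemb
  obtain ⟨g₀, hg₀, ε₁, hε₁, hg₀u⟩ := hG0.exists_div_pow (2 * n - 1)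
  obtain ⟨g₁, hg₁, ε₂, hε₂, hg₁u⟩ := hH0.exists_div_pow (n - 1)
  have hsndv : Tendsto (fun q : ℝ × ℝ × Λ => q.2) (nhds (0, 0, δ₀)) (nhds (0, δ₀)) :=
    continuous_snd.tendsto' _ _ rfl
  have hptc : Tendsto (fun q : ℝ × ℝ × Λ => (q.2.1, Φ q.2 + q.1, q.2.2)) (nhds (0, 0, δ₀))
      (nhds (0, 0, δ₀)) := by
    have := hpt.continuousAt.tendsto
    simpa [hΦ0] using this
  have hswap : Tendsto (fun q : ℝ × ℝ × Λ => (q.2.1, q.1, q.2.2)) (nhds (0, 0, δ₀))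
      (nhds (0, 0, δ₀)) := by
    apply Continuous.tendsto' (by fun_prop); rfl
  -- all the conditions hold on a common neighbourhood
  obtain ⟨η, hη, hball⟩ := Metric.eventually_nhds_iff_ball.1
    ((((hswap.eventually hX.eventually_analyticAt).and
      (hswap.eventually hY.eventually_analyticAt)).and
      ((hsndv.eventually (hΦ.eventually_analyticAt.and hΦe)).and (hswap.eventually hΦu))).and
      ((hKM.and (hGH.and hHh)).and ((hsndv.eventually hGd).and
        ((hptc.eventually hX.eventually_analyticAt).and (hptc.eventually hY.eventually_analyticAt)))))
  let ε := min η (min ε₁ ε₂)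
  have hεη : ε ≤ η := min_le_left _ _
  have hε1 : ε ≤ ε₁ := (min_le_right _ _).trans (min_le_left _ _)
  have hε2 : ε ≤ ε₂ := (min_le_right _ _).trans (min_le_right _ _)
  have hε : 0 < ε := lt_min hη (lt_min hε₁ hε₂)
  have hmem : ∀ x v δ, |x| < ε → |v| < ε → δ ∈ ball δ₀ ε → (v, x, δ) ∈ ball ((0 : ℝ), (0 : ℝ), δ₀) η := by
    intro x v δ hx hv hδ
    rw [Metric.mem_ball, Prod.dist_eq, Prod.dist_eq, max_lt_iff, max_lt_iff]
    simp only [Real.dist_eq, sub_zero]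
    exact ⟨hv.trans_le hεη, hx.trans_le hεη, lt_of_lt_of_le hδ hεη⟩
  have h0ε : |(0 : ℝ)| < ε := by simpa using hε
  have hK0 : ∀ x δ, |x| < ε → δ ∈ ball δ₀ ε → K (0, x, δ) = 0 := by
    intro x δ hx hδ
    have := (hball _ (hmem x 0 δ hx h0ε hδ)).1.2.1.2
    simpa [K] using this
  have hM0 : M (0, 0, δ₀) = 1 := by
    have h1 : HasDerivAt (fun v => K (v, 0, δ₀)) (M (0, 0, δ₀)) 0 := hKd.self_of_nhds
    have h2 : HasDerivAt (fun v => K (v, 0, δ₀)) 1 0 := by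
      have h3 : HasDerivAt (fun v => v + X 0 v δ₀) (1 + 0) 0 := (hasDerivAt_id (0 : ℝ)).add hXy
      simpa [K, hΦ0] using h3
    exact h1.unique h2
  -- identification of `F` with `Φ`
  have hFΦ : ∀ δ ∈ D ∩ ball δ₀ ε, ∀ᶠ x in nhds (0 : ℝ), |x| < ε ∧ F x δ = Φ (x, δ) := by
    rintro δ ⟨hδD, hδ⟩
    have hxe : ∀ᶠ x in nhds (0 : ℝ), |x| < ε := by
      filter_upwards [Metric.ball_mem_nhds (0 : ℝ) hε] with x hx
      simpa using hx
    have hFe : ∀ᶠ x in nhds (0 : ℝ), |F x δ| < ε := by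
      have := (hFc δ hδD).eventually (Metric.ball_mem_nhds (F 0 δ) hε)
      filter_upwards [this] with x hx
      simpa [hF0 δ hδD] using hx
    filter_upwards [hxe, hFe, hFsol δ hδD] with x hx hFx hs
    exact ⟨hx, (hball _ (hmem x (F x δ) δ hx hFx hδ)).1.2.2 hs⟩
  have hG0u : ∀ δ ∈ D ∩ ball δ₀ ε, g₀ (0, δ) = -a δ ∧
      ∀ x : ℝ, |x| < ε₁ → G (0, x, δ) = x ^ (2 * n - 1) * g₀ (x, δ) := by
    intro δ hδ
    obtain ⟨u, huc, hu0, hue⟩ := hg δ hδ.1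
    rw [← hu0]
    refine hg₀u δ (ball_subset_ball hε1 hδ.2) (fun x => -u x) huc.neg ?_
    filter_upwards [hue, hFΦ δ hδ] with x hx hxF
    have : Y x (F x δ) δ = -(x ^ (2 * n - 1) * u x) := by linarith
    simp only [G]
    rw [hK0 x δ hxF.1 hδ.2]
    simp [← hxF.2, this]
  have hG1u : ∀ δ ∈ D ∩ ball δ₀ ε, g₁ (0, δ) = -b δ ∧
      ∀ x : ℝ, |x| < ε₂ → H (0, x, δ) = x ^ (n - 1) * g₁ (x, δ) := by
    intro δ hδ
    obtain ⟨w, hwc, hw0, hwe⟩ := hf δ hδ.1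
    rw [← hw0]
    refine hg₁u δ (ball_subset_ball hε2 hδ.2) (fun x => -w x) hwc.neg ?_
    filter_upwards [hwe, hFΦ δ hδ] with x hx hxF
    have hb := hball _ (hmem x 0 δ hxF.1 h0ε hδ.2)
    have hGder : HasDerivAt (fun v => G (v, x, δ)) (H (0, x, δ)) 0 := hb.2.2.1
    have hXan : AnalyticAt ℝ (fun p : ℝ × ℝ × Λ => X p.1 p.2.1 p.2.2) (x, Φ (x, δ), δ) := by
      simpa using hb.2.2.2.1
    have hYan : AnalyticAt ℝ (fun p : ℝ × ℝ × Λ => Y p.1 p.2.1 p.2.2) (x, Φ (x, δ), δ) := by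
      simpa using hb.2.2.2.2
    set LX := fderiv ℝ (fun p : ℝ × ℝ × Λ => X p.1 p.2.1 p.2.2) (x, Φ (x, δ), δ)
    set LY := fderiv ℝ (fun p : ℝ × ℝ × Λ => Y p.1 p.2.1 p.2.2) (x, Φ (x, δ), δ)
    have hXd := hXan.differentiableAt.hasFDerivAt
    have hYd := hYan.differentiableAt.hasFDerivAt
    have hΦd : HasDerivAt (fun s => Φ (s, δ)) (deriv (fun s => Φ (s, δ)) x) x :=
      hb.1.2.1.1.slice.differentiableAt.hasDerivAt
    set Φx := deriv (fun s => Φ (s, δ)) x with hΦx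
    have hcy : HasDerivAt (fun s : ℝ => (x, s, δ)) ((0 : ℝ), (1 : ℝ), (0 : Λ)) (Φ (x, δ)) :=
      (hasDerivAt_const _ _).prodMk ((hasDerivAt_id _).prodMk (hasDerivAt_const _ _))
    have hcx : HasDerivAt (fun s : ℝ => (s, Φ (x, δ), δ)) ((1 : ℝ), (0 : ℝ), (0 : Λ)) x :=
      (hasDerivAt_id _).prodMk ((hasDerivAt_const _ _).prodMk (hasDerivAt_const _ _))
    have hcΦ : HasDerivAt (fun s : ℝ => (s, Φ (s, δ), δ)) ((1 : ℝ), Φx, (0 : Λ)) x :=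
      (hasDerivAt_id _).prodMk (hΦd.prodMk (hasDerivAt_const _ _))
    have hXx : HasDerivAt (fun s => X s (Φ (x, δ)) δ) (LX (1, 0, 0)) x :=
      HasFDerivAt.comp_hasDerivAt (f := fun s : ℝ => (s, Φ (x, δ), δ)) x hXd hcx
    have hXyd : HasDerivAt (fun s => X x s δ) (LX (0, 1, 0)) (Φ (x, δ)) :=
      HasFDerivAt.comp_hasDerivAt (f := fun s : ℝ => (x, s, δ)) (Φ (x, δ)) hXd hcy
    have hYyd : HasDerivAt (fun s => Y x s δ) (LY (0, 1, 0)) (Φ (x, δ)) :=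
      HasFDerivAt.comp_hasDerivAt (f := fun s : ℝ => (x, s, δ)) (Φ (x, δ)) hYd hcy
    have hXΦ : HasDerivAt (fun s => Φ (s, δ) + X s (Φ (s, δ)) δ) (Φx + LX (1, Φx, 0)) x :=
      hΦd.add (HasFDerivAt.comp_hasDerivAt (f := fun s : ℝ => (s, Φ (s, δ), δ)) x hXd hcΦ)
    have hzero : Φx + LX (1, Φx, 0) = 0 := by
      have h1 : (fun s => Φ (s, δ) + X s (Φ (s, δ)) δ) =ᶠ[nhds x] fun _ => 0 := by
        have : ∀ᶠ s in nhds x, |s| < ε := continuous_abs.continuousAt.eventually_lt_const hxF.1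
        filter_upwards [this] with s hs
        exact (hball _ (hmem s 0 δ hs h0ε hδ.2)).1.2.1.2
      exact hXΦ.unique ((hasDerivAt_const x (0 : ℝ)).congr_of_eventuallyEq h1)
    have hsplit : LX (1, Φx, 0) = LX (1, 0, 0) + Φx * LX (0, 1, 0) := by
      have : ((1 : ℝ), Φx, (0 : Λ)) = (1, 0, 0) + Φx • (0, 1, 0) := by simp
      rw [this, map_add, map_smul, smul_eq_mul]
    have hadd : HasDerivAt (fun v : ℝ => Φ (x, δ) + v) 1 0 := (hasDerivAt_id _).const_add _
    have hGder' : HasDerivAt (fun v => G (v, x, δ))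
        (LY (0, 1, 0) - Φx * (1 + LX (0, 1, 0))) 0 := by
      have e0 : Φ (x, δ) = Φ (x, δ) + 0 := by simp
      have h1 : HasDerivAt (fun v => Y x (Φ (x, δ) + v) δ) (LY (0, 1, 0)) 0 := by
        have := HasDerivAt.comp (h := fun v : ℝ => Φ (x, δ) + v) (0 : ℝ) (by rwa [← e0]) hadd
          (h₂ := fun s => Y x s δ) (h₂' := LY (0, 1, 0))
        simpa [Function.comp_def] using this
      have h2 : HasDerivAt (fun v => X x (Φ (x, δ) + v) δ) (LX (0, 1, 0)) 0 := by
        have := HasDerivAt.comp (h := fun v : ℝ => Φ (x, δ) + v) (0 : ℝ) (by rwa [← e0]) hadd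
          (h₂ := fun s => X x s δ) (h₂' := LX (0, 1, 0))
        simpa [Function.comp_def] using this
      exact h1.sub ((hadd.add h2).const_mul Φx)
    rw [hGder.unique hGder']
    rw [hxF.2, hXx.deriv, hYyd.deriv] at hx
    linear_combination -hx - hzero + hsplit
  refine ⟨⟨Φ, M, h, g₀, g₁, ε, hε, hM, hh, hg₀, hg₁, ?_, ?_, ?_, hM0, fun δ hδ => (hG0u δ hδ).1,
    fun δ hδ => (hG1u δ hδ).1, ?_, ?_, ?_, ?_⟩⟩
  · exact fun x δ hx hδ => (hball _ (hmem x 0 δ hx h0ε hδ)).1.2.1.1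
  · exact fun x y δ hx hy hδ => (hball _ (hmem x y δ hx hy hδ)).1.1.1
  · exact fun x y δ hx hy hδ => (hball _ (hmem x y δ hx hy hδ)).1.1.2
  · intro δ hδ
    rw [← (hFΦ δ hδ).self_of_nhds.2, hF0 δ hδ.1]
  · exact fun x y δ hx hy hδ h => (hball _ (hmem x y δ hx hy hδ)).1.2.2 h
  · intro x v δ hx hv hδ
    have := (hball _ (hmem x v δ hx hv hδ)).2.1.1
    rw [hK0 x δ hx hδ, zero_add] at this
    exact this
  · intro x v δ hx hv hδ
    have hb := (hball _ (hmem x v δ hx hv hδ.2)).2.1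
    have hKv : K (v, x, δ) = v * M (v, x, δ) := by
      have := hb.1
      rwa [hK0 x δ hx hδ.2, zero_add] at this
    have h1 : G (v, x, δ) = G (0, x, δ) + v * H (v, x, δ) := hb.2.1
    have h2 : H (v, x, δ) = H (0, x, δ) + v * h (v, x, δ) := hb.2.2
    rw [h2, (hG0u δ hδ).2 x (hx.trans_le hε1), (hG1u δ hδ).2 x (hx.trans_le hε2)] at h1
    have h3 : G (v, x, δ) = Y x (Φ (x, δ) + v) δ - deriv (fun s => Φ (s, δ)) x * K (v, x, δ) := rfl
    rw [h3, hKv] at h1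
    linear_combination h1

end NormalForm

section Lift

variable {Λ : Type*} [NormedAddCommGroup Λ] [NormedSpace ℝ Λ]
  {K : Type*} [TopologicalSpace K] [CompactSpace K]

/-- Substitution operators on `C(K, ℝ)` induced by analytic functions are analytic. -/
lemma AnalyticAt.exists_lift {f : ℝ × ℝ × Λ → ℝ} {l : Λ} (hf : AnalyticAt ℝ f (0, 0, l)) :
    ∃ N : C(K, ℝ) × C(K, ℝ) × Λ → C(K, ℝ), AnalyticAt ℝ N (0, 0, l) ∧
      ∀ᶠ q in nhds ((0 : C(K, ℝ)), (0 : C(K, ℝ)), l), ∀ s, N q s = f (q.1 s, q.2.1 s, q.2.2) := by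
  obtain ⟨N, hN, hNe⟩ := hf.exists_continuousMap_comp (K := K)
  let A : C(K, ℝ) × C(K, ℝ) × Λ → C(K, ℝ × ℝ × Λ) := fun q =>
    (ContinuousLinearMap.inl ℝ ℝ (ℝ × Λ)).compLeftContinuous ℝ _ q.1
      + (((ContinuousLinearMap.inr ℝ ℝ (ℝ × Λ)).comp
        (ContinuousLinearMap.inl ℝ ℝ Λ)).compLeftContinuous ℝ _ q.2.1
      + ContinuousLinearMap.const ℝ K ((0 : ℝ), (0 : ℝ), q.2.2))
  have hA : ∀ q s, A q s = (q.1 s, q.2.1 s, q.2.2) := by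
    intro q s
    have : ContinuousLinearMap.const ℝ K ((0 : ℝ), (0 : ℝ), q.2.2) s = (0, 0, q.2.2) := rfl
    simp [A, this]
  have hA0 : A (0, 0, l) = ContinuousMap.const K (0, 0, l) := by
    ext s : 1
    simp [hA]
  have hAan : AnalyticAt ℝ A (0, 0, l) := by
    refine AnalyticAt.add ?_ (AnalyticAt.add ?_ ?_)
    · exact AnalyticAt.comp (g := (ContinuousLinearMap.inl ℝ ℝ (ℝ × Λ)).compLeftContinuous ℝ K)
        (ContinuousLinearMap.analyticAt _ _) analyticAt_fst
    · exact AnalyticAt.comp (g := ((ContinuousLinearMap.inr ℝ ℝ (ℝ × Λ)).comp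
        (ContinuousLinearMap.inl ℝ ℝ Λ)).compLeftContinuous ℝ K)
        (ContinuousLinearMap.analyticAt _ _) (analyticAt_fst.comp analyticAt_snd)
    · exact AnalyticAt.comp (g := ContinuousLinearMap.const ℝ K)
        (ContinuousLinearMap.analyticAt _ _) (analyticAt_const.prod (analyticAt_const.prod
          (analyticAt_snd.comp analyticAt_snd)))
  refine ⟨N ∘ A, AnalyticAt.comp (by rwa [hA0]) hAan, ?_⟩
  have := hAan.continuousAt.tendsto
  rw [hA0] at this
  filter_upwards [this.eventually hNe] with q hq s
  rw [Function.comp_apply, hq s, hA]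

end Lift

lemma ContinuousMap.exp_apply {K : Type*} [TopologicalSpace K] [CompactSpace K] (w : C(K, ℝ))
    (s : K) : (NormedSpace.exp w : C(K, ℝ)) s = Real.exp (w s) := by
  rw [Real.exp_eq_exp_ℝ]
  exact NormedSpace.map_exp (ContinuousMap.evalAlgHom ℝ ℝ s : C(K, ℝ) →ₐ[ℝ] ℝ)
    (continuous_eval_const s) w

namespace NormalForm

variable {Λ : Type*} [NormedAddCommGroup Λ] [NormedSpace ℝ Λ]
  {D : Set Λ} {X Y : ℝ → ℝ → Λ → ℝ} {n : ℕ} {a b : Λ → ℝ} {δ₀ : Λ}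

/-- In polar coordinates `x = r cos θ`, `v = -rⁿ sin θ`, the equation for `x` is `x' = rⁿ k`. -/
noncomputable def k (nf : NormalForm D X Y n a b δ₀) (r θ : ℝ) (δ : Λ) : ℝ :=
  -Real.sin θ * nf.M (-(r ^ n * Real.sin θ), r * Real.cos θ, δ)

/-- In polar coordinates `x = r cos θ`, `v = -rⁿ sin θ`, the equation for `v` is
`v' = r ^ (2 * n - 1) q`. -/
noncomputable def q (nf : NormalForm D X Y n a b δ₀) (r θ : ℝ) (δ : Λ) : ℝ :=
  Real.cos θ ^ (2 * n - 1) * nf.g₀ (r * Real.cos θ, δ)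
    - Real.cos θ ^ (n - 1) * Real.sin θ * nf.g₁ (r * Real.cos θ, δ)
    + r * Real.sin θ ^ 2 * nf.h (-(r ^ n * Real.sin θ), r * Real.cos θ, δ)

/-- The denominator of the polar equation. -/
noncomputable def den (nf : NormalForm D X Y n a b δ₀) (r θ : ℝ) (δ : Λ) : ℝ :=
  -(Real.cos θ * nf.q r θ δ + n * (Real.sin θ * nf.k r θ δ))

lemma den_zero_pos (nf : NormalForm D X Y n a b δ₀) (hδ₀ : δ₀ ∈ D) (hn : 2 ≤ n) (ha : 0 < a δ₀)
    (hb : b δ₀ ^ 2 - 4 * n * a δ₀ < 0) (θ : ℝ) : 0 < nf.den 0 θ δ₀ := by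
  have hmem : δ₀ ∈ D ∩ ball δ₀ nf.ε := ⟨hδ₀, mem_ball_self nf.ε_pos⟩
  have hn0 : n ≠ 0 := by omega
  obtain ⟨m, rfl⟩ : ∃ m, n = m + 1 := ⟨n - 1, by omega⟩
  have e1 : nf.den 0 θ δ₀ = a δ₀ * (Real.cos θ ^ (m + 1)) ^ 2
      - b δ₀ * Real.cos θ ^ (m + 1) * Real.sin θ + (m + 1 : ℕ) * Real.sin θ ^ 2 := by
    have : 2 * (m + 1) - 1 = 2 * m + 1 := by omega
    simp only [den, q, k, zero_pow hn0, zero_mul, neg_zero, nf.M_zero, nf.g₀_zero _ hmem,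
      nf.g₁_zero _ hmem, this, Nat.add_sub_cancel]
    ring
  rw [e1]
  set c := Real.cos θ ^ (m + 1) with hc
  set s := Real.sin θ with hs
  have hN : (0 : ℝ) < (m + 1 : ℕ) := by positivity
  have key : 4 * a δ₀ * (a δ₀ * c ^ 2 - b δ₀ * c * s + (m + 1 : ℕ) * s ^ 2)
      = (2 * a δ₀ * c - b δ₀ * s) ^ 2 + (4 * (m + 1 : ℕ) * a δ₀ - b δ₀ ^ 2) * s ^ 2 := by ring
  have hpos : 0 < (2 * a δ₀ * c - b δ₀ * s) ^ 2
      + (4 * (m + 1 : ℕ) * a δ₀ - b δ₀ ^ 2) * s ^ 2 := by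
    by_cases h0 : s = 0
    · have hcos : Real.cos θ ≠ 0 := by
        intro h
        have := Real.sin_sq_add_cos_sq θ
        rw [← hs, h0, h] at this
        norm_num at this
      have : c ≠ 0 := pow_ne_zero _ hcos
      rw [h0]
      have : 0 < (2 * a δ₀ * c - b δ₀ * 0) ^ 2 := by
        apply sq_pos_of_ne_zero
        simpa using ⟨ha.ne', this⟩
      linarith [this]
    · have : 0 < (4 * (m + 1 : ℕ) * a δ₀ - b δ₀ ^ 2) * s ^ 2 :=
        mul_pos (by linarith) (sq_pos_of_ne_zero h0)
      positivity
  rw [← key] at hpos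
  exact pos_of_mul_pos_right hpos (by positivity)

lemma exists_angular_field (nf : NormalForm D X Y n a b δ₀) (hδ₀ : δ₀ ∈ D) (hn : 2 ≤ n)
    (ha : 0 < a δ₀) (hb : b δ₀ ^ 2 - 4 * n * a δ₀ < 0)
    {K : Type*} [TopologicalSpace K] [CompactSpace K] (ϑ : C(K, ℝ)) :
    ∃ S : C(K, ℝ) × Λ → C(K, ℝ),
      AnalyticAt ℝ S (0, δ₀) ∧
      ∀ᶠ p in nhds ((0 : C(K, ℝ)), δ₀),
        Continuous (fun θ : K => nf.den (p.1 θ) (ϑ θ) p.2) ∧ ∀ θ : K,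
        0 < nf.den (p.1 θ) (ϑ θ) p.2 ∧
        S p θ * nf.den (p.1 θ) (ϑ θ) p.2 =
          Real.cos (ϑ θ) * nf.k (p.1 θ) (ϑ θ) p.2 - Real.sin (ϑ θ) * nf.q (p.1 θ) (ϑ θ) p.2 := by
  have hn0 : n ≠ 0 := by omega
  obtain ⟨NM, hNM, hNMe⟩ := nf.analyticAt_M.exists_lift (K := K)
  obtain ⟨Nh, hNh, hNhe⟩ := nf.analyticAt_h.exists_lift (K := K)
  obtain ⟨N0, hN0, hN0e⟩ := AnalyticAt.exists_lift (K := K)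
    (f := fun q : ℝ × ℝ × Λ => nf.g₀ q.2) (l := δ₀)
    (AnalyticAt.comp (f := fun q : ℝ × ℝ × Λ => q.2) nf.analyticAt_g₀ analyticAt_snd)
  obtain ⟨N1, hN1, hN1e⟩ := AnalyticAt.exists_lift (K := K)
    (f := fun q : ℝ × ℝ × Λ => nf.g₁ q.2) (l := δ₀)
    (AnalyticAt.comp (f := fun q : ℝ × ℝ × Λ => q.2) nf.analyticAt_g₁ analyticAt_snd)
  let c : C(K, ℝ) := ⟨fun θ => Real.cos (ϑ θ), by fun_prop⟩
  let s : C(K, ℝ) := ⟨fun θ => Real.sin (ϑ θ), by fun_prop⟩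
  let pt : C(K, ℝ) × Λ →
      C(K, ℝ) × C(K, ℝ) × Λ :=
    fun p => (-(p.1 ^ n * s), p.1 * c, p.2)
  have hpt0 : pt (0, δ₀) = (0, 0, δ₀) := by simp [pt, hn0]
  have hpt : AnalyticAt ℝ pt (0, δ₀) :=
    ((analyticAt_fst.pow n).mul analyticAt_const).neg.prod
      ((analyticAt_fst.mul analyticAt_const).prod analyticAt_snd)
  have hptc : Tendsto pt (nhds (0, δ₀)) (nhds (0, 0, δ₀)) := by
    have := hpt.continuousAt.tendsto
    rwa [hpt0] at this
  let N : C(K, ℝ) := ContinuousMap.const K (n : ℝ)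
  let k : C(K, ℝ) × Λ → C(K, ℝ) := fun p => -s * NM (pt p)
  let q : C(K, ℝ) × Λ → C(K, ℝ) := fun p =>
    c ^ (2 * n - 1) * N0 (pt p) - c ^ (n - 1) * s * N1 (pt p) + p.1 * s ^ 2 * Nh (pt p)
  let B : C(K, ℝ) × Λ → C(K, ℝ) := fun p =>
    -(c * q p + N * (s * k p))
  have hcomp : ∀ {N : C(K, ℝ) × C(K, ℝ) × Λ →
      C(K, ℝ)}, AnalyticAt ℝ N (0, 0, δ₀) →
      AnalyticAt ℝ (fun p => N (pt p)) (0, δ₀) := by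
    intro N hN
    exact AnalyticAt.comp (g := N) (by rwa [hpt0]) hpt
  have hk : AnalyticAt ℝ k (0, δ₀) := analyticAt_const.fun_mul (hcomp hNM)
  have hq : AnalyticAt ℝ q (0, δ₀) :=
    ((analyticAt_const.fun_mul (hcomp hN0)).fun_sub (analyticAt_const.fun_mul (hcomp hN1))).fun_add
      ((analyticAt_fst.fun_mul analyticAt_const).fun_mul (hcomp hNh))
  have hB : AnalyticAt ℝ B (0, δ₀) :=
    ((analyticAt_const.fun_mul hq).fun_add (analyticAt_const.fun_mul (analyticAt_const.fun_mul hk))).fun_neg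
  have hev : ∀ᶠ p in nhds ((0 : C(K, ℝ)), δ₀), ∀ θ : K,
      k p θ = nf.k (p.1 θ) (ϑ θ) p.2 ∧ q p θ = nf.q (p.1 θ) (ϑ θ) p.2 ∧
      B p θ = nf.den (p.1 θ) (ϑ θ) p.2 := by
    filter_upwards [hptc.eventually hNMe, hptc.eventually hNhe, hptc.eventually hN0e,
      hptc.eventually hN1e] with p h1 h2 h3 h4 θ
    have e1 : k p θ = nf.k (p.1 θ) (ϑ θ) p.2 := by
      simp [k, NormalForm.k, h1, pt, s, c]
    have e2 : q p θ = nf.q (p.1 θ) (ϑ θ) p.2 := by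
      simp [q, NormalForm.q, h2, h3, h4, pt, s, c]
    refine ⟨e1, e2, ?_⟩
    simp [B, den, ← e1, ← e2, s, c, N]
  have hpos : ∀ᶠ p in nhds ((0 : C(K, ℝ)), δ₀), ∀ θ, 0 < B p θ := by
    have hopen : IsOpen {φ : C(K, ℝ) | MapsTo φ univ (Ioi 0)} :=
      ContinuousMap.isOpen_setOfPred_mapsTo isCompact_univ isOpen_Ioi
    have h0 : B (0, δ₀) ∈ {φ : C(K, ℝ) | MapsTo φ univ (Ioi 0)} := by
      intro θ _
      rw [mem_Ioi, (hev.self_of_nhds θ).2.2]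
      exact nf.den_zero_pos hδ₀ hn ha hb (ϑ θ)
    filter_upwards [hB.continuousAt (hopen.mem_nhds h0)] with p hp θ
    exact hp (mem_univ θ)
  have hunit : ∀ φ : C(K, ℝ), (∀ θ, 0 < φ θ) → IsUnit φ := fun φ hφ =>
    (ContinuousMap.isUnit_iff_forall_ne_zero φ).2 fun θ => (hφ θ).ne'
  refine ⟨fun p => (c * k p - s * q p) * Ring.inverse (B p), ?_, ?_⟩
  · refine ((analyticAt_const.fun_mul hk).fun_sub (analyticAt_const.fun_mul hq)).fun_mul ?_
    obtain ⟨u, hu⟩ := hunit _ hpos.self_of_nhds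
    exact AnalyticAt.comp (g := Ring.inverse) (hu ▸ analyticAt_inverse u) hB
  · filter_upwards [hev, hpos] with p h1 h2
    refine ⟨(B p).continuous.congr fun θ => (h1 θ).2.2, fun θ => ?_⟩
    refine ⟨(h1 θ).2.2 ▸ h2 θ, ?_⟩
    rw [← (h1 θ).1, ← (h1 θ).2.1, ← (h1 θ).2.2]
    have : (c * k p - s * q p) * Ring.inverse (B p) * B p = c * k p - s * q p := by
      rw [mul_assoc, Ring.inverse_mul_cancel _ (hunit _ h2), mul_one]
    exact congrArg (fun φ : C(K, ℝ) => φ θ) this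

end NormalForm

lemma exists_exp_volterra_fixedPoint {Λ : Type*} [NormedAddCommGroup Λ] [NormedSpace ℝ Λ]
    [CompleteSpace Λ] {L : ℝ} (hL : 0 ≤ L) {l : Λ}
    {S : C(Icc 0 L, ℝ) × Λ → C(Icc 0 L, ℝ)} (hS : AnalyticAt ℝ S (0, l)) :
    ∃ W : ℝ × Λ → C(Icc 0 L, ℝ), AnalyticAt ℝ W (0, l) ∧
      ∀ᶠ ν in nhds ((0 : ℝ), l),
        volterra L hL (S (ν.1 • NormedSpace.exp (W ν), ν.2)) = W ν := by
  let T : (ℝ × Λ) × C(Icc 0 L, ℝ) → C(Icc 0 L, ℝ) := fun p =>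
    volterra L hL (S (p.1.1 • NormedSpace.exp p.2, p.1.2))
  let w := volterra L hL (S (0, l))
  have hinner : AnalyticAt ℝ (fun p : (ℝ × Λ) × C(Icc 0 L, ℝ) =>
      (p.1.1 • NormedSpace.exp p.2, p.1.2)) ((0, l), w) := by
    have hexp : AnalyticAt ℝ (fun p : (ℝ × Λ) × C(Icc 0 L, ℝ) => NormedSpace.exp p.2)
        ((0, l), w) :=
      AnalyticAt.comp (g := NormedSpace.exp) (NormedSpace.exp_analytic _) analyticAt_snd
    exact ((analyticAt_fst.comp analyticAt_fst).smul hexp).prod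
      (analyticAt_snd.comp analyticAt_fst)
  have hT : AnalyticAt ℝ T ((0, l), w) :=
    AnalyticAt.comp (g := volterra L hL) ((volterra L hL).analyticAt _)
      (AnalyticAt.comp (g := S) (by simpa using hS) hinner)
  have hD : (fderiv ℝ T ((0, l), w)).comp
      (ContinuousLinearMap.inr ℝ (ℝ × Λ) C(Icc 0 L, ℝ)) = 0 := by
    have h1 : HasFDerivAt (fun φ : C(Icc 0 L, ℝ) => (((0 : ℝ), l), φ))
        (ContinuousLinearMap.inr ℝ (ℝ × Λ) C(Icc 0 L, ℝ)) w :=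
      hasFDerivAt_prodMk_right _ _
    have h2 := HasFDerivAt.comp (g := T) w hT.differentiableAt.hasFDerivAt h1
    refine h2.unique ?_
    have : T ∘ (fun φ : C(Icc 0 L, ℝ) => (((0 : ℝ), l), φ)) = fun _ => w := by
      funext φ
      simp [T, w]
    rw [this]
    exact hasFDerivAt_const _ _
  obtain ⟨W, hW, -, hWe, -⟩ := exists_analyticAt_fixedPoint hT (by simp [T, w]) hD
  exact ⟨W, hW, hWe⟩

/-- The curve `c` parametrizes one turn around the origin of a trajectory of the planar vector
field `(y + X, Y)`, starting and ending on the graph of `Φ`. -/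
structure IsTurn {Λ : Type*} (Φ : ℝ × Λ → ℝ) (X Y : ℝ → ℝ → Λ → ℝ) (δ : Λ) (η C ρ ρ' : ℝ)
    (c : ℝ → ℝ × ℝ) (σ : ℝ → ℝ) : Prop where
  start : c 0 = (ρ, Φ (ρ, δ))
  finish : c (2 * Real.pi) = (ρ', Φ (ρ', δ))
  mul_pos : 0 < ρ * ρ'
  half_neg : ρ * (c Real.pi).1 < 0
  half_eq : (c Real.pi).2 = Φ ((c Real.pi).1, δ)
  neg_of_eq : ∀ θ ∈ Ioo 0 (2 * Real.pi), (c θ).2 = Φ ((c θ).1, δ) → ρ * (c θ).1 < 0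
  hasDerivAt : ∀ θ ∈ Icc 0 (2 * Real.pi), HasDerivAt c
    (σ θ • ((c θ).2 + X (c θ).1 (c θ).2 δ, Y (c θ).1 (c θ).2 δ)) θ
  continuousOn : ContinuousOn σ (Icc 0 (2 * Real.pi))
  pos : 0 < ρ → ∀ θ ∈ Icc 0 (2 * Real.pi), 0 < σ θ
  abs_le : ∀ θ ∈ Icc 0 (2 * Real.pi), |(c θ).1| ≤ C * |ρ|
  small : ∀ θ ∈ Icc 0 (2 * Real.pi), |(c θ).1| < η ∧ |(c θ).2| < η

lemma NormalForm.hasDerivAt_polar {Λ : Type*} [NormedAddCommGroup Λ] [NormedSpace ℝ Λ]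
    {D : Set Λ} {X Y : ℝ → ℝ → Λ → ℝ} {n : ℕ} {a b : Λ → ℝ} {δ₀ δ : Λ}
    (nf : NormalForm D X Y n a b δ₀) (hn : 2 ≤ n) (hδ : δ ∈ D ∩ ball δ₀ nf.ε) {r : ℝ → ℝ}
    {θ S : ℝ} (hr0 : r θ ≠ 0) (hr : HasDerivAt r (r θ * S) θ) (hden : nf.den (r θ) θ δ ≠ 0)
    (hS : S * nf.den (r θ) θ δ =
      Real.cos θ * nf.k (r θ) θ δ - Real.sin θ * nf.q (r θ) θ δ)
    (hx : |r θ * Real.cos θ| < nf.ε) (hv : |-(r θ ^ n * Real.sin θ)| < nf.ε) {x y : ℝ}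
    (hxd : x = r θ * Real.cos θ) (hyd : y = nf.Φ (x, δ) + -(r θ ^ n * Real.sin θ)) :
    HasDerivAt (fun t => (r t * Real.cos t,
        nf.Φ (r t * Real.cos t, δ) + -(r t ^ n * Real.sin t)))
      (((Real.cos θ ^ 2 + n * Real.sin θ ^ 2) / (r θ ^ (n - 1) * nf.den (r θ) θ δ)) •
        (y + X x y δ, Y x y δ)) θ := by
  have hxe := nf.x_eq (r θ * Real.cos θ) (-(r θ ^ n * Real.sin θ)) δ hx hv hδ.2
  have hve := nf.v_eq (r θ * Real.cos θ) (-(r θ ^ n * Real.sin θ)) δ hx hv hδ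
  rw [← hxd] at hxe hve
  rw [← hyd] at hxe hve
  have hxder : HasDerivAt (fun t => r t * Real.cos t)
      (r θ * S * Real.cos θ + r θ * -Real.sin θ) θ := hr.mul (Real.hasDerivAt_cos θ)
  have hΦder : HasDerivAt (fun t => nf.Φ (r t * Real.cos t, δ))
      (deriv (fun s => nf.Φ (s, δ)) x * (r θ * S * Real.cos θ + r θ * -Real.sin θ)) θ := by
    have h1 : HasDerivAt (fun s => nf.Φ (s, δ)) (deriv (fun s => nf.Φ (s, δ)) x)
        (r θ * Real.cos θ) := by
      rw [hxd]
      exact (nf.analyticAt_Φ _ δ hx hδ.2).slice.differentiableAt.hasDerivAt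
    exact h1.comp θ hxder
  have hvder : HasDerivAt (fun t => -(r t ^ n * Real.sin t))
      (-((n * r θ ^ (n - 1) * (r θ * S)) * Real.sin θ + r θ ^ n * Real.cos θ)) θ :=
    ((hr.pow n).mul (Real.hasDerivAt_sin θ)).neg
  have hkdef : nf.k (r θ) θ δ = -Real.sin θ * nf.M (-(r θ ^ n * Real.sin θ), x, δ) := by
    rw [hxd]; rfl
  have hqdef : nf.q (r θ) θ δ = Real.cos θ ^ (2 * n - 1) * nf.g₀ (x, δ)
    - Real.cos θ ^ (n - 1) * Real.sin θ * nf.g₁ (x, δ)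
    + r θ * Real.sin θ ^ 2 * nf.h (-(r θ ^ n * Real.sin θ), x, δ) := by
    rw [hxd]; rfl
  have hBdef : nf.den (r θ) θ δ =
    -(Real.cos θ * nf.q (r θ) θ δ + n * (Real.sin θ * nf.k (r θ) θ δ)) := rfl
  generalize nf.den (r θ) θ δ = B at *
  generalize nf.q (r θ) θ δ = q at *
  generalize nf.k (r θ) θ δ = k at *
  have hV1 : y + X x y δ = r θ ^ n * k := by rw [hxe, hkdef]; ring
  obtain ⟨m, rfl⟩ : ∃ m, n = m + 1 := ⟨n - 1, by omega⟩
  have hV2 : Y x y δ = deriv (fun s => nf.Φ (s, δ)) x * (r θ ^ (m + 1) * k)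
      + r θ ^ (2 * (m + 1) - 1) * q := by
    rw [hve, hkdef, hqdef, hxd]
    have : 2 * (m + 1) - 1 = 2 * m + 1 := by omega
    rw [this, Nat.add_sub_cancel]
    ring
  have hm : 2 * (m + 1) - 1 = 2 * m + 1 := by omega
  have hSB : S = (Real.cos θ * k - Real.sin θ * q) / B := by rw [eq_div_iff hden, hS]
  have e1 : r θ * S * Real.cos θ + r θ * -Real.sin θ =
      (Real.cos θ ^ 2 + (m + 1 : ℕ) * Real.sin θ ^ 2) / (r θ ^ m * B) * (r θ ^ (m + 1) * k) := by
    have hrm : r θ ^ m ≠ 0 := pow_ne_zero _ hr0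
    rw [hSB]
    field_simp
    rw [hBdef]
    ring
  have e2 : -(((m + 1 : ℕ) * r θ ^ m * (r θ * S)) * Real.sin θ + r θ ^ (m + 1) * Real.cos θ) =
      (Real.cos θ ^ 2 + (m + 1 : ℕ) * Real.sin θ ^ 2) / (r θ ^ m * B) *
        (r θ ^ (2 * m + 1) * q) := by
    have hrm : r θ ^ m ≠ 0 := pow_ne_zero _ hr0
    rw [hSB]
    field_simp
    rw [hBdef]
    ring
  refine (hxder.prodMk (hΦder.add hvder)).congr_deriv ?_
  simp only [Nat.add_sub_cancel]
  rw [hV1, hV2, hm, e2, e1]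
  simp only [Prod.smul_mk, smul_eq_mul]
  congr 1
  ring

lemma NormalForm.exists_turn {Λ : Type*} [NormedAddCommGroup Λ] [NormedSpace ℝ Λ]
    [CompleteSpace Λ] {D : Set Λ} {X Y : ℝ → ℝ → Λ → ℝ} {n : ℕ} {a b : Λ → ℝ} {δ₀ : Λ}
    (nf : NormalForm D X Y n a b δ₀) (hδ₀ : δ₀ ∈ D) (hn : 2 ≤ n) (ha : 0 < a δ₀)
    (hb : b δ₀ ^ 2 - 4 * n * a δ₀ < 0) :
    ∃ R : ℝ × Λ → ℝ, AnalyticAt ℝ R (0, δ₀) ∧ 0 < deriv (fun ρ => R (ρ, δ₀)) 0 ∧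
      (∀ δ, R (0, δ) = 0) ∧ ∃ C, 0 < C ∧ ∃ η > 0, ∀ δ ∈ D ∩ ball δ₀ η, ∀ ρ : ℝ, ρ ≠ 0 → |ρ| < η →
        ∃ c σ, IsTurn nf.Φ X Y δ nf.ε C ρ (R (ρ, δ)) c σ := by
  have hL : (0 : ℝ) ≤ 2 * Real.pi := by positivity
  let ϑ : C(Icc 0 (2 * Real.pi), ℝ) := ⟨Subtype.val, continuous_subtype_val⟩
  obtain ⟨S, hS, hSe⟩ := nf.exists_angular_field hδ₀ hn ha hb ϑ
  obtain ⟨W, hW, hWe⟩ := exists_exp_volterra_fixedPoint hL hS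
  let last : Icc 0 (2 * Real.pi) := ⟨2 * Real.pi, right_mem_Icc.2 hL⟩
  have hlast : AnalyticAt ℝ (fun q : ℝ × Λ => Real.exp (W q last)) (0, δ₀) :=
    AnalyticAt.comp (g := Real.exp) analyticAt_rexp
      (AnalyticAt.comp (g := ContinuousMap.evalCLM ℝ last) (ContinuousLinearMap.analyticAt _ _) hW)
  let R : ℝ × Λ → ℝ := fun q => q.1 * Real.exp (W q last)
  have hR : AnalyticAt ℝ R (0, δ₀) := analyticAt_fst.fun_mul hlast
  let ω : ℝ × Λ → C(Icc 0 (2 * Real.pi), ℝ) := fun q => q.1 • NormedSpace.exp (W q)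
  have hω : AnalyticAt ℝ ω (0, δ₀) :=
    analyticAt_fst.smul (AnalyticAt.comp (g := NormedSpace.exp) (NormedSpace.exp_analytic _) hW)
  have hω0 : ω (0, δ₀) = 0 := by simp [ω]
  have hωt : Tendsto ω (nhds (0, δ₀)) (nhds 0) := by
    have := hω.continuousAt.tendsto
    rwa [hω0] at this
  have hωδ : Tendsto (fun q : ℝ × Λ => (ω q, q.2)) (nhds (0, δ₀)) (nhds (0, δ₀)) :=
    hωt.prodMk_nhds (continuous_snd.tendsto' _ _ rfl)
  have hδ₀' : δ₀ ∈ D ∩ ball δ₀ nf.ε := ⟨hδ₀, mem_ball_self nf.ε_pos⟩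
  obtain ⟨κ, hκ, hΦκ⟩ : ∃ κ > 0, ∀ x δ, |x| < κ → δ ∈ ball δ₀ κ → |nf.Φ (x, δ)| < nf.ε / 2 := by
    have h1 : ∀ᶠ q in nhds ((0 : ℝ), δ₀), |nf.Φ q| < nf.ε / 2 := by
      have hc := (nf.analyticAt_Φ 0 δ₀ (by simpa using nf.ε_pos) hδ₀'.2).continuousAt.abs
      refine hc.eventually_lt_const ?_
      simpa [nf.Φ_zero δ₀ hδ₀'] using nf.ε_pos
    obtain ⟨κ, hκ, hb⟩ := Metric.eventually_nhds_iff_ball.1 h1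
    refine ⟨κ, hκ, fun x δ hx hδ => hb _ ?_⟩
    rw [Metric.mem_ball, Prod.dist_eq, max_lt_iff]
    exact ⟨by simpa using hx, hδ⟩
  have hωs : ∀ᶠ q in nhds ((0 : ℝ), δ₀), ‖ω q‖ < min (min κ (nf.ε / 2)) 1 := by
    refine hωt.norm.eventually_lt_const ?_
    rw [norm_zero]
    exact lt_min (lt_min hκ (half_pos nf.ε_pos)) one_pos
  have hWs : ∀ᶠ q in nhds ((0 : ℝ), δ₀), ‖W q‖ < ‖W (0, δ₀)‖ + 1 :=
    hW.continuousAt.norm.eventually_lt_const (lt_add_one _)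
  obtain ⟨η, hη, hball⟩ := Metric.eventually_nhds_iff_ball.1
    ((hWe.and (hωs.and hWs)).and (hωδ.eventually hSe))
  refine ⟨R, hR, ?_, fun δ => by simp [R], Real.exp (‖W (0, δ₀)‖ + 1), Real.exp_pos _, min η (min κ nf.ε), lt_min hη (lt_min hκ nf.ε_pos), ?_⟩
  · have h1 : HasDerivAt (fun ρ : ℝ => ρ * Real.exp (W (ρ, δ₀) last))
        (1 * Real.exp (W (0, δ₀) last) + 0 * fderiv ℝ (fun q : ℝ × Λ => Real.exp (W q last))
          (0, δ₀) (1, 0)) 0 := (hasDerivAt_id (0 : ℝ)).mul hlast.hasDerivAt_slice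
    have h2 : deriv (fun ρ => R (ρ, δ₀)) 0 = Real.exp (W (0, δ₀) last) := by
      have := h1.deriv
      simpa using this
    rw [h2]
    exact Real.exp_pos _
  · rintro δ ⟨hδD, hδ⟩ ρ hρ0 hρ
    have hδκ : δ ∈ ball δ₀ κ := ball_subset_ball ((min_le_right _ _).trans (min_le_left _ _)) hδ
    have hδε : δ ∈ D ∩ ball δ₀ nf.ε :=
      ⟨hδD, ball_subset_ball ((min_le_right _ _).trans (min_le_right _ _)) hδ⟩
    have hmem : (ρ, δ) ∈ ball ((0 : ℝ), δ₀) η := by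
      rw [Metric.mem_ball, Prod.dist_eq, max_lt_iff]
      exact ⟨by simpa using hρ.trans_le (min_le_left _ _),
        lt_of_lt_of_le hδ (min_le_left _ _)⟩
    obtain ⟨⟨hWν, hων, hWb⟩, hcont, hSν⟩ := hball _ hmem
    let s : ℝ → ℝ := IccExtend hL (S (ω (ρ, δ), δ))
    have hs : Continuous s := (S (ω (ρ, δ), δ)).continuous.Icc_extend'
    let r : ℝ → ℝ := fun θ => ρ * Real.exp (∫ t in (0 : ℝ)..θ, s t)
    have hrω : ∀ θ (hθ : θ ∈ Icc 0 (2 * Real.pi)), r θ = ω (ρ, δ) ⟨θ, hθ⟩ := by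
      intro θ hθ
      have h1 : W (ρ, δ) ⟨θ, hθ⟩ = ∫ t in (0 : ℝ)..θ, s t := by
        rw [← hWν, volterra_apply]
      simp only [r, ω]
      rw [ContinuousMap.smul_apply, ContinuousMap.exp_apply, h1, smul_eq_mul]
    have hr : ∀ θ, HasDerivAt r (r θ * s θ) θ := by
      intro θ
      have := ((intervalIntegral.integral_hasDerivAt_right (hs.intervalIntegrable 0 θ)
        (hs.stronglyMeasurableAtFilter _ _) hs.continuousAt).exp.const_mul ρ)
      simpa [r, mul_assoc] using this
    have hrpos : ∀ θ, 0 < ρ * r θ := by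
      intro θ
      have : ρ * r θ = ρ ^ 2 * Real.exp (∫ t in (0 : ℝ)..θ, s t) := by simp only [r]; ring
      rw [this]
      exact mul_pos (sq_pos_of_ne_zero hρ0) (Real.exp_pos _)
    have hr0 : ∀ θ, r θ ≠ 0 := fun θ h => by simpa [h] using hrpos θ
    have hrs : ∀ θ ∈ Icc 0 (2 * Real.pi), |r θ| < min (min κ (nf.ε / 2)) 1 := by
      intro θ hθ
      rw [hrω θ hθ]
      exact ((ω (ρ, δ)).norm_coe_le_norm ⟨θ, hθ⟩).trans_lt hων
    have hden : ∀ θ ∈ Icc 0 (2 * Real.pi), 0 < nf.den (r θ) θ δ ∧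
        s θ * nf.den (r θ) θ δ =
          Real.cos θ * nf.k (r θ) θ δ - Real.sin θ * nf.q (r θ) θ δ := by
      intro θ hθ
      have := hSν ⟨θ, hθ⟩
      have hsθ : s θ = S (ω (ρ, δ), δ) ⟨θ, hθ⟩ := IccExtend_of_mem hL _ hθ
      rw [hrω θ hθ, hsθ]
      exact this
    have hxs : ∀ θ ∈ Icc 0 (2 * Real.pi), |r θ * Real.cos θ| < min κ (nf.ε / 2) := by
      intro θ hθ
      rw [abs_mul]
      calc |r θ| * |Real.cos θ| ≤ |r θ| * 1 := by gcongr; exact Real.abs_cos_le_one θ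
        _ < min κ (nf.ε / 2) := by rw [mul_one]; exact (hrs θ hθ).trans_le (min_le_left _ _)
    have hvs : ∀ θ ∈ Icc 0 (2 * Real.pi), |-(r θ ^ n * Real.sin θ)| < nf.ε / 2 := by
      intro θ hθ
      rw [abs_neg, abs_mul, abs_pow]
      have h1 : |r θ| ^ n ≤ |r θ| :=
        pow_le_of_le_one (abs_nonneg _) ((hrs θ hθ).le.trans (min_le_right _ _)) (by omega)
      calc |r θ| ^ n * |Real.sin θ| ≤ |r θ| * 1 := by
            gcongr; exact Real.abs_sin_le_one θ
        _ < nf.ε / 2 := by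
            rw [mul_one]
            exact (hrs θ hθ).trans_le ((min_le_left _ _).trans (min_le_right _ _))
    have hhalf : nf.ε / 2 < nf.ε := half_lt_self nf.ε_pos
    refine ⟨fun t => (r t * Real.cos t, nf.Φ (r t * Real.cos t, δ) + -(r t ^ n * Real.sin t)),
      fun θ => (Real.cos θ ^ 2 + n * Real.sin θ ^ 2) / (r θ ^ (n - 1) * nf.den (r θ) θ δ), ?_⟩
    have hn1 : (1 : ℝ) ≤ n := by exact_mod_cast (by omega : 1 ≤ n)
    have hRr : R (ρ, δ) = r (2 * Real.pi) := by
      rw [hrω _ (right_mem_Icc.2 hL)]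
      simp only [R, ω]
      rw [ContinuousMap.smul_apply, ContinuousMap.exp_apply, smul_eq_mul]
    refine ⟨?_, ?_, ?_, ?_, ?_, ?_, ?_, ?_, ?_, ?_, ?_⟩
    · simp [r]
    · simp [hRr]
    · rw [hRr]
      exact hrpos _
    · have := hrpos Real.pi
      simp only [Real.cos_pi]
      linarith
    · simp
    · intro θ hθ h
      have hsin : Real.sin θ = 0 := by
        have h1 : r θ ^ n * Real.sin θ = 0 := by
          have : nf.Φ (r θ * Real.cos θ, δ) + -(r θ ^ n * Real.sin θ)
            = nf.Φ (r θ * Real.cos θ, δ) := h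
          linarith
        exact (mul_eq_zero.1 h1).resolve_left (pow_ne_zero _ (hr0 θ))
      have hθπ : θ = Real.pi := by
        rcases lt_trichotomy θ Real.pi with h1 | h1 | h1
        · exact absurd hsin (Real.sin_pos_of_pos_of_lt_pi hθ.1 h1).ne'
        · exact h1
        · have : Real.sin (θ - 2 * Real.pi) < 0 :=
            Real.sin_neg_of_neg_of_neg_pi_lt (by linarith [hθ.2]) (by linarith)
          rw [Real.sin_sub_two_pi] at this
          exact absurd hsin this.ne
      have := hrpos Real.pi
      rw [hθπ]
      simp only [Real.cos_pi]
      linarith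
    · intro θ hθ
      exact nf.hasDerivAt_polar hn hδε (hr0 θ) (hr θ) (hden θ hθ).1.ne' (hden θ hθ).2
        ((hxs θ hθ).trans_le ((min_le_right _ _).trans hhalf.le)) ((hvs θ hθ).trans hhalf) rfl rfl
    · have hdc : ContinuousOn (fun θ => nf.den (r θ) θ δ) (Icc 0 (2 * Real.pi)) := by
        rw [continuousOn_iff_continuous_domRestrict]
        refine hcont.congr fun θ => ?_
        simp only [Set.domRestrict_apply]
        rw [hrω θ θ.2]
        rfl
      have hrc : Continuous r := continuous_iff_continuousAt.2 fun θ => (hr θ).continuousAt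
      refine ContinuousOn.div (by fun_prop) ((hrc.pow _).continuousOn.mul hdc) fun θ hθ => ?_
      exact mul_ne_zero (pow_ne_zero _ (hr0 θ)) (hden θ hθ).1.ne'
    · intro hρ θ hθ
      have hrp : 0 < r θ := (mul_pos_iff_of_pos_left hρ).1 (hrpos θ)
      have h1 := (hden θ hθ).1
      have h2 := Real.sin_sq_add_cos_sq θ
      have : 0 < Real.cos θ ^ 2 + n * Real.sin θ ^ 2 := by
        nlinarith [sq_nonneg (Real.sin θ)]
      positivity
    · intro θ hθ
      have h1 : |r θ| ≤ Real.exp (‖W (0, δ₀)‖ + 1) * |ρ| := by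
        rw [hrω θ hθ]
        simp only [ω]
        rw [ContinuousMap.smul_apply, ContinuousMap.exp_apply, smul_eq_mul, abs_mul,
          Real.abs_exp, mul_comm]
        gcongr
        exact (le_abs_self _).trans (((W (ρ, δ)).norm_coe_le_norm ⟨θ, hθ⟩).trans hWb.le)
      calc |r θ * Real.cos θ| = |r θ| * |Real.cos θ| := abs_mul _ _
        _ ≤ |r θ| * 1 := by gcongr; exact Real.abs_cos_le_one θ
        _ ≤ Real.exp (‖W (0, δ₀)‖ + 1) * |ρ| := by rw [mul_one]; exact h1
    · intro θ hθ
      refine ⟨(hxs θ hθ).trans_le ((min_le_right _ _).trans hhalf.le), ?_⟩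
      have h1 := hΦκ (r θ * Real.cos θ) δ ((hxs θ hθ).trans_le (min_le_left _ _)) hδκ
      calc |nf.Φ (r θ * Real.cos θ, δ) + -(r θ ^ n * Real.sin θ)|
          ≤ |nf.Φ (r θ * Real.cos θ, δ)| + |-(r θ ^ n * Real.sin θ)| := abs_add_le _ _
        _ < nf.ε / 2 + nf.ε / 2 := add_lt_add h1 (hvs θ hθ)
        _ = nf.ε := by ring

/-- The planar vector field of the system for the parameter value `δ`. -/
def planarField {Λ : Type*} (X Y : ℝ → ℝ → Λ → ℝ) (δ : Λ) (p : ℝ × ℝ) : ℝ × ℝ :=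
  (p.2 + X p.1 p.2 δ, Y p.1 p.2 δ)

lemma exists_lipschitzOnWith_planarField {Λ : Type*} [NormedAddCommGroup Λ] [NormedSpace ℝ Λ]
    {X Y : ℝ → ℝ → Λ → ℝ} {δ : Λ} {p : ℝ × ℝ}
    (hX : AnalyticAt ℝ (fun p : ℝ × ℝ × Λ => X p.1 p.2.1 p.2.2) (p.1, p.2, δ))
    (hY : AnalyticAt ℝ (fun p : ℝ × ℝ × Λ => Y p.1 p.2.1 p.2.2) (p.1, p.2, δ)) :
    ∃ K, ∃ s ∈ nhds p, LipschitzOnWith K (planarField X Y δ) s := by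
  have he : AnalyticAt ℝ (fun p : ℝ × ℝ => (p.1, p.2, δ)) p :=
    analyticAt_fst.prod (analyticAt_snd.prod analyticAt_const)
  have h1 : AnalyticAt ℝ (fun p : ℝ × ℝ => X p.1 p.2 δ) p :=
    AnalyticAt.comp (g := fun p : ℝ × ℝ × Λ => X p.1 p.2.1 p.2.2)
      (f := fun p : ℝ × ℝ => (p.1, p.2, δ)) (x := p) hX he
  have h2 : AnalyticAt ℝ (fun p : ℝ × ℝ => Y p.1 p.2 δ) p :=
    AnalyticAt.comp (g := fun p : ℝ × ℝ × Λ => Y p.1 p.2.1 p.2.2)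
      (f := fun p : ℝ × ℝ => (p.1, p.2, δ)) (x := p) hY he
  have h : AnalyticAt ℝ (planarField X Y δ) p := (analyticAt_snd.fun_add h1).prod h2
  exact (h.contDiffAt (n := 1)).exists_lipschitzOnWith

namespace IsTurn

variable {Λ : Type*} {Φ : ℝ × Λ → ℝ} {X Y : ℝ → ℝ → Λ → ℝ} {δ : Λ} {η C ρ ρ' : ℝ}
  {c : ℝ → ℝ × ℝ} {σ : ℝ → ℝ} {γ : ℝ → ℝ × ℝ}

/-- A solution meeting a turn follows it. -/
lemma exists_time (h : IsTurn Φ X Y δ η C ρ ρ' c σ)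
    (hLip : ∀ p : ℝ × ℝ, |p.1| < η → |p.2| < η →
      ∃ K, ∃ s ∈ nhds p, LipschitzOnWith K (planarField X Y δ) s)
    (hγ : ∀ t, HasDerivAt γ (planarField X Y δ (γ t)) t) {θ₀ t₀ : ℝ}
    (hθ₀ : θ₀ ∈ Icc 0 (2 * Real.pi)) (heq : γ t₀ = c θ₀) :
    ∃ τ : ℝ → ℝ, τ θ₀ = t₀ ∧ (∀ θ ∈ Icc 0 (2 * Real.pi), HasDerivAt τ (σ θ) θ) ∧
      ∀ θ ∈ Icc 0 (2 * Real.pi), γ (τ θ) = c θ := by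
  have hL : (0 : ℝ) ≤ 2 * Real.pi := by positivity
  let s : ℝ → ℝ := IccExtend hL ((Icc 0 (2 * Real.pi)).domRestrict σ)
  have hs : Continuous s :=
    (continuousOn_iff_continuous_domRestrict.1 h.continuousOn).Icc_extend'
  have hsσ : ∀ θ ∈ Icc 0 (2 * Real.pi), s θ = σ θ := fun θ hθ => IccExtend_of_mem hL _ hθ
  let τ : ℝ → ℝ := fun θ => t₀ + ∫ u in θ₀..θ, s u
  have hτ : ∀ θ ∈ Icc 0 (2 * Real.pi), HasDerivAt τ (σ θ) θ := by
    intro θ hθ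
    have := (intervalIntegral.integral_hasDerivAt_right (hs.intervalIntegrable θ₀ θ)
      (hs.stronglyMeasurableAtFilter _ _) hs.continuousAt).const_add t₀
    rwa [hsσ θ hθ] at this
  have hτ0 : τ θ₀ = t₀ := by simp [τ]
  refine ⟨τ, hτ0, hτ, ?_⟩
  refine eqOn_Icc_of_hasDerivAt_smul (f := fun θ => γ (τ θ)) (v := planarField X Y δ)
    h.continuousOn (fun θ hθ => (hγ (τ θ)).scomp θ (hτ θ hθ)) h.hasDerivAt
    (fun θ hθ => hLip _ (h.small θ hθ).1 (h.small θ hθ).2) hθ₀ ?_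
  simp only [hτ0, heq]

lemma mem_range (h : IsTurn Φ X Y δ η C ρ ρ' c σ)
    (hLip : ∀ p : ℝ × ℝ, |p.1| < η → |p.2| < η →
      ∃ K, ∃ s ∈ nhds p, LipschitzOnWith K (planarField X Y δ) s)
    (hγ : ∀ t, HasDerivAt γ (planarField X Y δ (γ t)) t) {θ₁ θ₂ : ℝ}
    (hθ₁ : θ₁ ∈ Icc 0 (2 * Real.pi)) (hθ₂ : θ₂ ∈ Icc 0 (2 * Real.pi))
    (hmem : c θ₁ ∈ range γ) : c θ₂ ∈ range γ := by
  obtain ⟨t, ht⟩ := hmem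
  obtain ⟨τ, -, -, hτ⟩ := h.exists_time hLip hγ hθ₁ ht
  exact ⟨τ θ₂, hτ θ₂ hθ₂⟩

/-- The end point of a turn is the first return of the corresponding solution. -/
lemma fst_eq_of_first_return (h : IsTurn Φ X Y δ η C ρ ρ' c σ) (hρ : 0 < ρ)
    (hLip : ∀ p : ℝ × ℝ, |p.1| < η → |p.2| < η →
      ∃ K, ∃ s ∈ nhds p, LipschitzOnWith K (planarField X Y δ) s)
    {F : ℝ → ℝ} (hF : ∀ x, |x| ≤ C * |ρ| → F x = Φ (x, δ))
    (hγ : ∀ t, HasDerivAt γ (planarField X Y δ (γ t)) t) (hγ0 : γ 0 = (ρ, F ρ)) {τ : ℝ}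
    (hτ : 0 < τ) (hret : (γ τ).2 = F (γ τ).1 ∧ 0 < ρ * (γ τ).1)
    (hfirst : ∀ t, 0 < t → t < τ → ¬((γ t).2 = F (γ t).1 ∧ 0 < ρ * (γ t).1)) :
    (γ τ).1 = ρ' := by
  have hpi : 0 < 2 * Real.pi := by positivity
  have h0 : (0 : ℝ) ∈ Icc 0 (2 * Real.pi) := left_mem_Icc.2 hpi.le
  have h2 : 2 * Real.pi ∈ Icc 0 (2 * Real.pi) := right_mem_Icc.2 hpi.le
  have hFρ : F ρ = Φ (ρ, δ) := by
    refine hF ρ ?_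
    simpa [h.start] using h.abs_le 0 h0
  have hFρ' : F ρ' = Φ (ρ', δ) := by
    refine hF ρ' ?_
    simpa [h.finish] using h.abs_le _ h2
  obtain ⟨s, hs0, hs, hγs⟩ := h.exists_time hLip hγ h0 (t₀ := 0) (by rw [hγ0, h.start, hFρ])
  have hsc : ContinuousOn s (Icc 0 (2 * Real.pi)) := fun θ hθ =>
    (hs θ hθ).continuousAt.continuousWithinAt
  have hmono : StrictMonoOn s (Icc 0 (2 * Real.pi)) := by
    refine strictMonoOn_of_deriv_pos (convex_Icc _ _) hsc fun θ hθ => ?_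
    have hθ' := interior_subset hθ
    rw [(hs θ hθ').deriv]
    exact h.pos hρ θ hθ'
  have hend : 0 < s (2 * Real.pi) := by
    rw [← hs0]
    exact hmono h0 h2 hpi
  have hle : τ ≤ s (2 * Real.pi) := by
    by_contra! hlt
    refine hfirst _ hend hlt ?_
    rw [hγs _ h2, h.finish]
    exact ⟨hFρ'.symm, h.mul_pos⟩
  obtain ⟨θ, hθ, hsθ⟩ := intermediate_value_Icc hpi.le hsc (by rw [hs0]; exact ⟨hτ.le, hle⟩)
  have hθ0 : 0 < θ := by
    refine lt_of_le_of_ne hθ.1 fun h => ?_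
    rw [← h, hs0] at hsθ
    exact hτ.ne hsθ
  rcases hθ.2.lt_or_eq with hlt | heq
  · exfalso
    rw [← hsθ, hγs θ hθ, hF _ (h.abs_le θ hθ)] at hret
    exact absurd (h.neg_of_eq θ ⟨hθ0, hlt⟩ hret.1) hret.2.not_gt
  · rw [← hsθ, heq, hγs _ h2, h.finish]

end IsTurn

/-- The extreme points of a nonconstant periodic solution near the origin are fixed points of the
return map. -/
lemma exists_fixedPoints_of_periodic {Λ : Type*} {Φ : ℝ × Λ → ℝ} {X Y : ℝ → ℝ → Λ → ℝ} {δ : Λ}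
    {ε C η υ : ℝ} {R : ℝ → ℝ}
    (hLip : ∀ p : ℝ × ℝ, |p.1| < ε → |p.2| < ε →
      ∃ K, ∃ s ∈ nhds p, LipschitzOnWith K (planarField X Y δ) s)
    (hΦ0 : Φ (0, δ) = 0) (h0 : planarField X Y δ 0 = 0)
    (hΦ : ∀ x y, |x| < ε → |y| < ε → y + X x y δ = 0 → y = Φ (x, δ))
    (hmono : MonotoneOn R (Ioo (-η) η)) (hR0 : R 0 = 0)
    (hsurj : ∀ x, |x| < υ → ∃ z ∈ Ioo (-η) η, R z = x)
    (hturn : ∀ ρ, ρ ≠ 0 → |ρ| < η → ∃ c σ, IsTurn Φ X Y δ ε C ρ (R ρ) c σ)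
    (hυε : υ ≤ ε) (hυη : υ ≤ η) {γ : ℝ → ℝ × ℝ} {T : ℝ}
    (hγ : ∀ t, HasDerivAt γ (planarField X Y δ (γ t)) t) (hT : 0 < T)
    (hper : Function.Periodic γ T) (hnc : ∃ t, γ t ≠ γ 0)
    (hU : ∀ t, |(γ t).1| < υ ∧ |(γ t).2| < υ) :
    ∃ p ∈ Ioo 0 υ, ∃ q ∈ Ioo (-υ) 0, R p = p ∧ R q = q ∧
      (p, Φ (p, δ)) ∈ range γ ∧ (q, Φ (q, δ)) ∈ range γ := by
  have hpi : (0 : ℝ) < Real.pi := Real.pi_pos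
  have m0 : (0 : ℝ) ∈ Icc 0 (2 * Real.pi) := ⟨le_rfl, by linarith⟩
  have m1 : Real.pi ∈ Icc 0 (2 * Real.pi) := ⟨hpi.le, by linarith⟩
  have m2 : 2 * Real.pi ∈ Icc 0 (2 * Real.pi) := ⟨by linarith, le_rfl⟩
  have hγc : Continuous γ := continuous_iff_continuousAt.2 fun t => (hγ t).continuousAt
  have hcomp : IsCompact (range γ) := hper.compact_of_continuous hT.ne' hγc
  have hne : (range γ).Nonempty := range_nonempty γ
  have hfst : ∀ t, HasDerivAt (fun s => (γ s).1) ((γ t).2 + X (γ t).1 (γ t).2 δ) t := fun t =>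
    (hasFDerivAt_fst (𝕜 := ℝ) (p := γ t)).comp_hasDerivAt t (hγ t)
  have hcrit : ∀ t, (γ t).2 + X (γ t).1 (γ t).2 δ = 0 →
      γ t = ((γ t).1, Φ ((γ t).1, δ)) := by
    intro t ht
    exact Prod.ext rfl (hΦ _ _ ((hU t).1.trans_le hυε) ((hU t).2.trans_le hυε) ht)
  have hnz : ∀ t, γ t = ((γ t).1, Φ ((γ t).1, δ)) → (γ t).1 ≠ 0 := by
    intro t ht h
    rw [h, hΦ0] at ht
    have hε : 0 < ε := (abs_nonneg _).trans_lt ((hU t).1.trans_le hυε)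
    have hzero : γ = fun _ => (0 : ℝ × ℝ) := by
      refine eq_of_hasDerivAt_autonomous (v := planarField X Y δ) (t₀ := t) hγ (fun s => ?_)
        (fun s => hLip _ (by simpa using hε) (by simpa using hε)) ht
      rw [h0]
      exact hasDerivAt_const _ _
    obtain ⟨s, hs⟩ := hnc
    simp [hzero] at hs
  have hhalf : ∀ t, γ t = ((γ t).1, Φ ((γ t).1, δ)) → ∃ s, (γ t).1 * (γ s).1 < 0 := by
    intro t ht
    obtain ⟨c, σ, hc⟩ := hturn _ (hnz t ht) ((hU t).1.trans_le hυη)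
    obtain ⟨s, hs⟩ := hc.mem_range hLip hγ m0 m1 ⟨t, by rw [hc.start, ← ht]⟩
    exact ⟨s, by rw [hs]; exact hc.half_neg⟩
  have hnext : ∀ t, γ t = ((γ t).1, Φ ((γ t).1, δ)) → ∃ s, (γ s).1 = R (γ t).1 := by
    intro t ht
    obtain ⟨c, σ, hc⟩ := hturn _ (hnz t ht) ((hU t).1.trans_le hυη)
    obtain ⟨s, hs⟩ := hc.mem_range hLip hγ m0 m2 ⟨t, by rw [hc.start, ← ht]⟩
    exact ⟨s, by rw [hs, hc.finish]⟩
  have hprev : ∀ t, γ t = ((γ t).1, Φ ((γ t).1, δ)) →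
      ∃ s, R (γ s).1 = (γ t).1 := by
    intro t ht
    obtain ⟨z, hz, hRz⟩ := hsurj _ (hU t).1
    have hz0 : z ≠ 0 := by
      rintro rfl
      exact hnz t ht (by rw [← hRz, hR0])
    obtain ⟨c, σ, hc⟩ := hturn z hz0 (abs_lt.2 hz)
    obtain ⟨s, hs⟩ := hc.mem_range hLip hγ m2 m0 ⟨t, by rw [hc.finish, hRz, ← ht]⟩
    exact ⟨s, by rw [hs, hc.start, hRz]⟩
  have hIoo : ∀ t, (γ t).1 ∈ Ioo (-η) η := fun t => abs_lt.1 ((hU t).1.trans_le hυη)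
  obtain ⟨_, ⟨t₁, rfl⟩, hmax⟩ := hcomp.exists_isMaxOn hne continuous_fst.continuousOn
  obtain ⟨_, ⟨t₂, rfl⟩, hmin⟩ := hcomp.exists_isMinOn hne continuous_fst.continuousOn
  have hmax' : ∀ t, (γ t).1 ≤ (γ t₁).1 := fun t => hmax (mem_range_self t)
  have hmin' : ∀ t, (γ t₂).1 ≤ (γ t).1 := fun t => hmin (mem_range_self t)
  have e1 : γ t₁ = ((γ t₁).1, Φ ((γ t₁).1, δ)) := hcrit t₁
    (IsLocalMax.hasDerivAt_eq_zero (Eventually.of_forall hmax') (hfst t₁))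
  have e2 : γ t₂ = ((γ t₂).1, Φ ((γ t₂).1, δ)) := hcrit t₂
    (IsLocalMin.hasDerivAt_eq_zero (Eventually.of_forall hmin') (hfst t₂))
  have p1 : 0 < (γ t₁).1 := by
    by_contra! hle
    obtain ⟨s, hs⟩ := hhalf t₁ e1
    nlinarith [hmax' s]
  have p2 : (γ t₂).1 < 0 := by
    by_contra! hle
    obtain ⟨s, hs⟩ := hhalf t₂ e2
    nlinarith [hmin' s]
  refine ⟨(γ t₁).1, ⟨p1, (abs_lt.1 (hU t₁).1).2⟩, (γ t₂).1, ⟨(abs_lt.1 (hU t₂).1).1, p2⟩,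
    ?_, ?_, ⟨t₁, e1⟩, ⟨t₂, e2⟩⟩
  · obtain ⟨s, hs⟩ := hnext t₁ e1
    obtain ⟨s', hs'⟩ := hprev t₁ e1
    exact le_antisymm (hs.symm.le.trans (hmax' s))
      (hs'.symm.le.trans (hmono (hIoo s') (hIoo t₁) (hmax' s')))
  · obtain ⟨s, hs⟩ := hnext t₂ e2
    obtain ⟨s', hs'⟩ := hprev t₂ e2
    exact le_antisymm ((hmono (hIoo t₂) (hIoo s') (hmin' s')).trans hs'.le)
      ((hmin' s).trans hs.le)

/-- Analytic functions agreeing on the right of the origin agree near the origin, uniformly in the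
parameter. -/
lemma AnalyticAt.exists_eq_of_eventually_eq_right {Λ : Type*} [NormedAddCommGroup Λ]
    [NormedSpace ℝ Λ] {G H : ℝ × Λ → ℝ} {δ₀ : Λ} (hG : AnalyticAt ℝ G (0, δ₀))
    (hH : AnalyticAt ℝ H (0, δ₀)) :
    ∃ κ > 0, ∀ δ ∈ ball δ₀ κ,
      (∀ᶠ ρ in nhdsWithin (0 : ℝ) (Ioi 0), G (ρ, δ) = H (ρ, δ)) →
      ∀ ρ, |ρ| < κ → G (ρ, δ) = H (ρ, δ) := by
  obtain ⟨κ, hκ, hb⟩ := Metric.eventually_nhds_iff_ball.1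
    (hG.eventually_analyticAt.and hH.eventually_analyticAt)
  have hb' : ∀ δ ∈ ball δ₀ κ, ∀ ρ ∈ Ioo (-κ) κ,
      AnalyticAt ℝ G (ρ, δ) ∧ AnalyticAt ℝ H (ρ, δ) := by
    intro δ hδ ρ hρ
    refine hb _ ?_
    rw [Metric.mem_ball, Prod.dist_eq, max_lt_iff]
    exact ⟨by simpa using abs_lt.2 hρ, hδ⟩
  refine ⟨κ, hκ, fun δ hδ he ρ hρ => ?_⟩
  have h1 : AnalyticOnNhd ℝ (fun ρ => G (ρ, δ)) (Ioo (-κ) κ) := fun x hx => (hb' δ hδ x hx).1.slice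
  have h2 : AnalyticOnNhd ℝ (fun ρ => H (ρ, δ)) (Ioo (-κ) κ) := fun x hx => (hb' δ hδ x hx).2.slice
  exact h1.eqOn_of_preconnected_of_frequently_eq h2 isPreconnected_Ioo (z₀ := 0)
    ⟨by linarith, hκ⟩
    (he.frequently.filter_mono (nhdsWithin_mono _ fun x (hx : 0 < x) => hx.ne')) (abs_lt.1 hρ)

/-- Solutions of an autonomous equation with a common point have the same orbit. -/
lemma range_eq_of_mem_of_mem {E : Type*} [NormedAddCommGroup E] [NormedSpace ℝ E] {w : E → E}
    {γ₁ γ₂ : ℝ → E} (h₁ : ∀ t, HasDerivAt γ₁ (w (γ₁ t)) t) (h₂ : ∀ t, HasDerivAt γ₂ (w (γ₂ t)) t)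
    (hw : ∀ t, ∃ K, ∃ s ∈ nhds (γ₂ t), LipschitzOnWith K w s) {z : E} (hz₁ : z ∈ range γ₁)
    (hz₂ : z ∈ range γ₂) : range γ₁ = range γ₂ := by
  obtain ⟨t₁, rfl⟩ := hz₁
  obtain ⟨t₂, ht⟩ := hz₂
  have h : γ₁ = fun t => γ₂ (t + (t₂ - t₁)) := by
    refine eq_of_hasDerivAt_autonomous (t₀ := t₁) (v := w) h₁
      (fun t => (h₂ _).comp_add_const t _) (fun t => hw _) ?_
    simp [ht]
  rw [h]
  exact (Equiv.addRight (t₂ - t₁)).surjective.range_comp γ₂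

lemma card_periodicOrbits_le {mp : ℕ} {X Y : ℝ → ℝ → (Fin mp → ℝ) → ℝ} {δ : Fin mp → ℝ}
    {Φ : ℝ × (Fin mp → ℝ) → ℝ} {ε C η υ : ℝ} {R : ℝ → ℝ}
    (hLip : ∀ p : ℝ × ℝ, |p.1| < ε → |p.2| < ε →
      ∃ K, ∃ s ∈ nhds p, LipschitzOnWith K (planarField X Y δ) s)
    (hΦ0 : Φ (0, δ) = 0) (h0 : planarField X Y δ 0 = 0)
    (hΦ : ∀ x y, |x| < ε → |y| < ε → y + X x y δ = 0 → y = Φ (x, δ))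
    (hmono : MonotoneOn R (Ioo (-η) η)) (hR0 : R 0 = 0)
    (hsurj : ∀ x, |x| < υ → ∃ z ∈ Ioo (-η) η, R z = x)
    (hturn : ∀ ρ, ρ ≠ 0 → |ρ| < η → ∃ c σ, IsTurn Φ X Y δ ε C ρ (R ρ) c σ)
    (hυ : 0 < υ) (hυε : υ ≤ ε) (hυη : υ ≤ η) (m : ℕ)
    (hana : ∀ x ∈ Ioo (-υ) υ, AnalyticAt ℝ (fun x => R x - x) x)
    (hm : ∀ x ∈ Ioo (-υ) υ, iteratedDeriv m (fun x => R x - x) x ≠ 0)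
    (S : Finset (Set (ℝ × ℝ)))
    (hS : ∀ Γ ∈ S, IsPeriodicOrbit19 mp X Y δ Γ ∧ Γ ⊆ {p | |p.1| < υ ∧ |p.2| < υ}) :
    2 * S.card + 1 ≤ m := by
  classical
  have hpt : ∀ Γ ∈ S, ∃ γ : ℝ → ℝ × ℝ, (∀ t, HasDerivAt γ (planarField X Y δ (γ t)) t) ∧
      Γ = range γ ∧ (∀ t, |(γ t).1| < υ ∧ |(γ t).2| < υ) ∧
      ∃ p ∈ Ioo 0 υ, ∃ q ∈ Ioo (-υ) 0, R p = p ∧ R q = q ∧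
      (p, Φ (p, δ)) ∈ range γ ∧ (q, Φ (q, δ)) ∈ range γ := by
    intro Γ hΓ
    obtain ⟨⟨γ, T, hT, hγ, hper, hnc, rfl⟩, hsub⟩ := hS Γ hΓ
    have hγ' : ∀ t, HasDerivAt γ (planarField X Y δ (γ t)) t := fun t =>
      (hγ t).1.prodMk (hγ t).2
    have hU : ∀ t, |(γ t).1| < υ ∧ |(γ t).2| < υ := fun t => hsub (mem_range_self t)
    exact ⟨γ, hγ', rfl, hU, exists_fixedPoints_of_periodic hLip hΦ0 h0 hΦ hmono hR0 hsurj hturn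
      hυε hυη hγ' hT hper hnc hU⟩
  choose! γ hγ hr hU p hp q hq hRp hRq hpm hqm using hpt
  have hinj : ∀ Γ ∈ S, ∀ Γ' ∈ S, ∀ z, z ∈ range (γ Γ) → z ∈ range (γ Γ') → Γ = Γ' := by
    intro Γ hΓ Γ' hΓ' z hz hz'
    rw [hr Γ hΓ, hr Γ' hΓ']
    exact range_eq_of_mem_of_mem (hγ Γ hΓ) (hγ Γ' hΓ') (fun t => hLip _
      ((hU Γ' hΓ' t).1.trans_le hυε) ((hU Γ' hΓ' t).2.trans_le hυε)) hz hz'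
  have hpi : InjOn p S := by
    intro Γ hΓ Γ' hΓ' h
    refine hinj Γ hΓ Γ' hΓ' _ (hpm Γ hΓ) ?_
    rw [h]
    exact hpm Γ' hΓ'
  have hqi : InjOn q S := by
    intro Γ hΓ Γ' hΓ' h
    refine hinj Γ hΓ Γ' hΓ' _ (hqm Γ hΓ) ?_
    rw [h]
    exact hqm Γ' hΓ'
  have hd1 : Disjoint (S.image p) (S.image q) := by
    rw [Finset.disjoint_left]
    intro x hx hx'
    obtain ⟨Γ, hΓ, rfl⟩ := Finset.mem_image.1 hx
    obtain ⟨Γ', hΓ', h⟩ := Finset.mem_image.1 hx'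
    have h1 := (hp Γ hΓ).1
    have h2 := (hq Γ' hΓ').2
    linarith
  have hd2 : (0 : ℝ) ∉ S.image p ∪ S.image q := by
    intro hx
    rcases Finset.mem_union.1 hx with hx | hx
    · obtain ⟨Γ, hΓ, h⟩ := Finset.mem_image.1 hx
      exact (hp Γ hΓ).1.ne' h
    · obtain ⟨Γ, hΓ, h⟩ := Finset.mem_image.1 hx
      exact (hq Γ hΓ).2.ne h
  have hcard := card_le_of_iteratedDeriv_ne_zero m hana hm (insert 0 (S.image p ∪ S.image q)) <| by
    intro x hx
    rcases Finset.mem_insert.1 hx with rfl | hx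
    · exact ⟨⟨by linarith, hυ⟩, by simp [hR0]⟩
    rcases Finset.mem_union.1 hx with hx | hx
    · obtain ⟨Γ, hΓ, rfl⟩ := Finset.mem_image.1 hx
      exact ⟨⟨by linarith [(hp Γ hΓ).1], (hp Γ hΓ).2⟩, sub_eq_zero.2 (hRp Γ hΓ)⟩
    · obtain ⟨Γ, hΓ, rfl⟩ := Finset.mem_image.1 hx
      exact ⟨⟨(hq Γ hΓ).1, by linarith [(hq Γ hΓ).2]⟩, sub_eq_zero.2 (hRq Γ hΓ)⟩
  rw [Finset.card_insert_of_notMem hd2, Finset.card_union_of_disjoint hd1,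
    Finset.card_image_of_injOn hpi, Finset.card_image_of_injOn hqi] at hcard
  omega

/-- An increasing one-parameter family of analytic functions fixing the origin is locally
invertible, uniformly in the parameter. -/
lemma AnalyticAt.exists_monotoneOn_surjOn {Λ : Type*} [NormedAddCommGroup Λ] [NormedSpace ℝ Λ]
    {R : ℝ × Λ → ℝ} {δ₀ : Λ} (hR : AnalyticAt ℝ R (0, δ₀))
    (hd : 0 < deriv (fun ρ => R (ρ, δ₀)) 0) (hR0 : ∀ δ, R (0, δ) = 0) {η₀ : ℝ} (hη₀ : 0 < η₀) :
    ∃ η > 0, η ≤ η₀ ∧ ∃ υ > 0, υ ≤ η ∧ ∀ δ ∈ ball δ₀ η,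
      MonotoneOn (fun ρ => R (ρ, δ)) (Ioo (-η) η) ∧
      ∀ x, |x| < υ → ∃ z ∈ Ioo (-η) η, R (z, δ) = x := by
  set d := deriv (fun ρ => R (ρ, δ₀)) 0 with hd_def
  have h1 : ∀ᶠ q in nhds ((0 : ℝ), δ₀),
      AnalyticAt ℝ R q ∧ d / 2 < deriv (fun y => R (y, q.2)) q.1 :=
    hR.eventually_analyticAt.and
      (hR.partial_deriv.continuousAt.eventually_const_lt (half_lt_self hd))
  obtain ⟨κ, hκ, hb⟩ := Metric.eventually_nhds_iff_ball.1 h1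
  set η := min κ η₀ with hη_def
  have hη : 0 < η := lt_min hκ hη₀
  have hb' : ∀ δ ∈ ball δ₀ η, ∀ ρ ∈ Ioo (-η) η,
      HasDerivAt (fun y => R (y, δ)) (deriv (fun y => R (y, δ)) ρ) ρ ∧
      d / 2 < deriv (fun y => R (y, δ)) ρ := by
    intro δ hδ ρ hρ
    have hmem : (ρ, δ) ∈ ball ((0 : ℝ), δ₀) κ := by
      rw [Metric.mem_ball, Prod.dist_eq, max_lt_iff]
      exact ⟨by simpa using (abs_lt.2 hρ).trans_le (min_le_left _ _),
        (mem_ball.1 hδ).trans_le (min_le_left _ _)⟩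
    exact ⟨(hb _ hmem).1.slice.differentiableAt.hasDerivAt, (hb _ hmem).2⟩
  refine ⟨η, hη, min_le_right _ _, min η (d / 2 * (η / 2)), lt_min hη (by positivity),
    min_le_left _ _, fun δ hδ => ⟨?_, ?_⟩⟩
  · refine monotoneOn_of_deriv_nonneg (convex_Ioo _ _)
      (fun x hx => (hb' δ hδ x hx).1.continuousAt.continuousWithinAt)
      (fun x hx => (hb' δ hδ x (interior_subset hx)).1.differentiableAt.differentiableWithinAt)
      fun x hx => ?_
    have := (hb' δ hδ x (interior_subset hx)).2
    linarith
  · intro x hx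
    have hx' : |x| < d / 2 * (η / 2) := hx.trans_le (min_le_right _ _)
    rw [abs_lt] at hx'
    have hgrow : ∀ s t, s ∈ Ioo (-η) η → t ∈ Ioo (-η) η → s ≤ t →
        d / 2 * (t - s) ≤ R (t, δ) - R (s, δ) := by
      intro s t hs ht hst
      refine (convex_Ioo (-η) η).mul_sub_le_image_sub_of_le_deriv
        (fun x hx => (hb' δ hδ x hx).1.continuousAt.continuousWithinAt)
        (fun x hx => (hb' δ hδ x (interior_subset hx)).1.differentiableAt.differentiableWithinAt)
        (fun x hx => (hb' δ hδ x (interior_subset hx)).2.le) s hs t ht hst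
    have m0 : (0 : ℝ) ∈ Ioo (-η) η := ⟨by linarith, hη⟩
    have m1 : η / 2 ∈ Ioo (-η) η := ⟨by linarith, by linarith⟩
    have m2 : -(η / 2) ∈ Ioo (-η) η := ⟨by linarith, by linarith⟩
    have g1 := hgrow 0 (η / 2) m0 m1 (by linarith)
    have g2 := hgrow (-(η / 2)) 0 m2 m0 (by linarith)
    rw [hR0] at g1 g2
    obtain ⟨z, hz, hRz⟩ := intermediate_value_Icc (f := fun y => R (y, δ))
      (show -(η / 2) ≤ η / 2 by linarith)
      (fun y hy => (hb' δ hδ y ⟨by linarith [hy.1], by linarith [hy.2]⟩).1.continuousAt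
        |>.continuousWithinAt) (show x ∈ Icc (R (-(η / 2), δ)) (R (η / 2, δ)) from
        ⟨by linarith, by linarith⟩)
    exact ⟨z, ⟨by linarith [hz.1], by linarith [hz.2]⟩, hRz⟩

/-- A return map is given by the turns. -/
lemma NormalForm.eventually_return_eq {Λ : Type*} [NormedAddCommGroup Λ] [NormedSpace ℝ Λ]
    {D : Set Λ} {X Y : ℝ → ℝ → Λ → ℝ} {n : ℕ} {a b : Λ → ℝ} {δ₀ δ : Λ}
    (nf : NormalForm D X Y n a b δ₀) (hδ : δ ∈ ball δ₀ nf.ε) {C η : ℝ} {R P F : ℝ → ℝ}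
    (hη : 0 < η)
    (hturn : ∀ ρ, ρ ≠ 0 → |ρ| < η → ∃ c σ, IsTurn nf.Φ X Y δ nf.ε C ρ (R ρ) c σ)
    (hFc : ContinuousAt F 0) (hF0 : F 0 = 0) (hFsol : ∀ᶠ x in nhds 0, F x + X x (F x) δ = 0)
    (hP : ∃ ε > 0, ∀ x₀ : ℝ, x₀ ≠ 0 → |x₀| < ε →
      ∃ γ : ℝ → ℝ × ℝ, γ 0 = (x₀, F x₀) ∧ (∀ t, HasDerivAt γ (planarField X Y δ (γ t)) t) ∧
        ∃ τ : ℝ, 0 < τ ∧ ((γ τ).2 = F (γ τ).1 ∧ 0 < x₀ * (γ τ).1) ∧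
          (∀ t, 0 < t → t < τ → ¬((γ t).2 = F (γ t).1 ∧ 0 < x₀ * (γ t).1)) ∧ P x₀ = (γ τ).1) :
    ∀ᶠ ρ in nhdsWithin (0 : ℝ) (Ioi 0), P ρ = R ρ := by
  obtain ⟨ε, hε, hP⟩ := hP
  have hsmall : ∀ᶠ x in nhds (0 : ℝ), |F x| < nf.ε :=
    hFc.abs.eventually_lt_const (by simpa [hF0] using nf.ε_pos)
  have hFΦ : ∀ᶠ x in nhds (0 : ℝ), F x = nf.Φ (x, δ) := by
    filter_upwards [hFsol, hsmall, eventually_abs_sub_lt 0 nf.ε_pos] with x h1 h2 h3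
    exact nf.eq_Φ x (F x) δ (by simpa using h3) h2 hδ h1
  obtain ⟨r, hr, hrF⟩ := Metric.eventually_nhds_iff_ball.1 hFΦ
  have hC : ∀ᶠ ρ in nhds (0 : ℝ), C * |ρ| < r :=
    (show ContinuousAt (fun ρ : ℝ => C * |ρ|) 0 by fun_prop).eventually_lt_const (by simpa using hr)
  filter_upwards [self_mem_nhdsWithin, nhdsWithin_le_nhds hC,
    nhdsWithin_le_nhds (eventually_abs_sub_lt (0 : ℝ) hη),
    nhdsWithin_le_nhds (eventually_abs_sub_lt (0 : ℝ) hε)] with ρ hρ h1 h2 h3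
  rw [sub_zero] at h2 h3
  obtain ⟨γ, hγ0, hγ, τ, hτ, hret, hfirst, hPρ⟩ := hP ρ (ne_of_gt hρ) h3
  obtain ⟨c, σ, hc⟩ := hturn ρ (ne_of_gt hρ) h2
  rw [hPρ]
  refine hc.fst_eq_of_first_return hρ (fun p hp hp' => exists_lipschitzOnWith_planarField
    (nf.analyticAt_X _ _ _ hp hp' hδ) (nf.analyticAt_Y _ _ _ hp hp' hδ))
    (fun x hx => hrF x ?_) hγ hγ0 hτ hret hfirst
  simpa using hx.trans_lt h1

/-- Near a parameter value at which `v_m` does not vanish, at most `(m - 1) / 2` periodic orbits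
lie in a neighborhood of the origin. -/
lemma NormalForm.exists_card_periodicOrbits_le {mp : ℕ} {D : Set (Fin mp → ℝ)}
    {X Y : ℝ → ℝ → (Fin mp → ℝ) → ℝ} {n : ℕ} {a b : (Fin mp → ℝ) → ℝ} {δ₀ : Fin mp → ℝ}
    (nf : NormalForm D X Y n a b δ₀) (hδ₀ : δ₀ ∈ D) (hn : 2 ≤ n) (ha : 0 < a δ₀)
    (hb : b δ₀ ^ 2 - 4 * n * a δ₀ < 0) (h0 : ∀ δ ∈ D, planarField X Y δ 0 = 0)
    {F P Pb : ℝ → (Fin mp → ℝ) → ℝ} (hFc : ∀ δ ∈ D, ContinuousAt (fun x => F x δ) 0)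
    (hF0 : ∀ δ ∈ D, F 0 δ = 0)
    (hFsol : ∀ δ ∈ D, ∀ᶠ x in nhds (0 : ℝ), F x δ + X x (F x δ) δ = 0)
    (hP : ∀ δ ∈ D, ∃ ε > 0, ∀ x₀ : ℝ, x₀ ≠ 0 → |x₀| < ε →
      ∃ γ : ℝ → ℝ × ℝ, γ 0 = (x₀, F x₀ δ) ∧ (∀ t, HasDerivAt γ (planarField X Y δ (γ t)) t) ∧
        ∃ τ : ℝ, 0 < τ ∧ ((γ τ).2 = F (γ τ).1 δ ∧ 0 < x₀ * (γ τ).1) ∧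
          (∀ t, 0 < t → t < τ → ¬((γ t).2 = F (γ t).1 δ ∧ 0 < x₀ * (γ t).1)) ∧
          P x₀ δ = (γ τ).1)
    (hPb : ∀ δ ∈ D, ∀ᶠ x in nhdsWithin (0 : ℝ) (Ioi 0), P x δ = Pb x δ)
    (hPbjoint : AnalyticAt ℝ (fun p : ℝ × (Fin mp → ℝ) => Pb p.1 p.2) (0, δ₀)) (m : ℕ)
    (hm : iteratedDeriv m (fun x => Pb x δ₀ - x) 0 ≠ 0) :
    ∃ U ∈ nhds (0 : ℝ × ℝ), ∃ V ∈ nhds δ₀, ∀ δ ∈ D ∩ V, ∀ S : Finset (Set (ℝ × ℝ)),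
      (∀ Γ ∈ S, IsPeriodicOrbit19 mp X Y δ Γ ∧ Γ ⊆ U) → 2 * S.card + 1 ≤ m := by
  obtain ⟨R, hR, hRd, hR0, C, hC, η₀, hη₀, hturn⟩ := nf.exists_turn hδ₀ hn ha hb
  obtain ⟨κ, hκ, hκR⟩ := hR.exists_eq_of_eventually_eq_right hPbjoint
  have hRPb : ∀ δ ∈ D, δ ∈ ball δ₀ nf.ε → δ ∈ ball δ₀ η₀ → δ ∈ ball δ₀ κ →
      ∀ ρ, |ρ| < κ → R (ρ, δ) = Pb ρ δ := by
    intro δ hδ h1 h2 h3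
    refine hκR δ h3 ?_
    filter_upwards [hPb δ hδ, nf.eventually_return_eq h1 hη₀ (hturn δ ⟨hδ, h2⟩) (hFc δ hδ)
      (hF0 δ hδ) (hFsol δ hδ) (hP δ hδ)] with ρ e1 e2
    rw [← e1, e2]
  have hm₀ : iteratedDeriv m (fun x => R (x, δ₀) - x) 0 ≠ 0 := by
    have he : (fun x => R (x, δ₀) - x) =ᶠ[nhds 0] fun x => Pb x δ₀ - x := by
      filter_upwards [eventually_abs_sub_lt (0 : ℝ) hκ] with x hx
      rw [hRPb δ₀ hδ₀ (mem_ball_self nf.ε_pos) (mem_ball_self hη₀) (mem_ball_self hκ) x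
        (by simpa using hx)]
    rwa [he.iteratedDeriv_eq m]
  have hG : AnalyticAt ℝ (fun q : ℝ × (Fin mp → ℝ) => R q - q.1) (0, δ₀) :=
    hR.fun_sub analyticAt_fst
  obtain ⟨r, hr, hrG⟩ := Metric.eventually_nhds_iff_ball.1 (hG.eventually_analyticAt.and
    ((hG.partial_iteratedDeriv m).continuousAt.eventually_ne hm₀))
  obtain ⟨η, hη, hηη₀, υ, hυ, hυη, hRη⟩ := hR.exists_monotoneOn_surjOn hRd hR0
    (lt_min hη₀ (lt_min nf.ε_pos hr))
  have hη1 : η ≤ η₀ := hηη₀.trans (min_le_left _ _)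
  have hη2 : η ≤ nf.ε := hηη₀.trans ((min_le_right _ _).trans (min_le_left _ _))
  have hη3 : η ≤ r := hηη₀.trans ((min_le_right _ _).trans (min_le_right _ _))
  refine ⟨{p | |p.1| < υ ∧ |p.2| < υ}, ?_, ball δ₀ η, ball_mem_nhds _ hη, ?_⟩
  · refine IsOpen.mem_nhds ?_ (by simpa using hυ)
    exact (isOpen_lt continuous_fst.abs continuous_const).inter
      (isOpen_lt continuous_snd.abs continuous_const)
  rintro δ ⟨hδ, hδη⟩ S hS
  have hδε : δ ∈ ball δ₀ nf.ε := ball_subset_ball hη2 hδη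
  have hmem : ∀ x ∈ Ioo (-υ) υ, (x, δ) ∈ ball ((0 : ℝ), δ₀) r := by
    intro x hx
    rw [Metric.mem_ball, Prod.dist_eq, max_lt_iff]
    exact ⟨by simpa using (abs_lt.2 hx).trans_le (hυη.trans hη3), (mem_ball.1 hδη).trans_le hη3⟩
  exact card_periodicOrbits_le (Φ := nf.Φ) (R := fun ρ => R (ρ, δ)) (ε := nf.ε)
    (fun p hp hp' => exists_lipschitzOnWith_planarField
      (nf.analyticAt_X _ _ _ hp hp' hδε) (nf.analyticAt_Y _ _ _ hp hp' hδε))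
    (nf.Φ_zero δ ⟨hδ, hδε⟩) (h0 δ hδ) (fun x y hx hy h => nf.eq_Φ x y δ hx hy hδε h)
    (hRη δ hδη).1 (hR0 δ) (hRη δ hδη).2
    (fun ρ h h' => hturn δ ⟨hδ, ball_subset_ball hη1 hδη⟩ ρ h (h'.trans_le hη1))
    hυ (hυη.trans hη2) hυη m (fun x hx => (hrG _ (hmem x hx)).1.slice)
    (fun x hx => (hrG _ (hmem x hx)).2) S hS

lemma Set.finite_and_ncard_le_of_forall_finset_card_le {α : Type*} {s : Set α} {k : ℕ}
    (h : ∀ S : Finset α, ↑S ⊆ s → S.card ≤ k) : s.Finite ∧ s.ncard ≤ k := by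
  have hfin : s.Finite := by
    by_contra hinf
    obtain ⟨S, hS, hcard⟩ := Set.Infinite.exists_subset_card_eq hinf (k + 1)
    have := h S hS
    omega
  refine ⟨hfin, ?_⟩
  rw [Set.ncard_eq_toFinset_card s hfin]
  exact h _ (by simp)

/-- **Theorem 1.6(1) (Bifurcation from Focus, upper bound).**  If
`Σ_{j=1}^{k+1} |v_{2j-1+pₙ}(δ)| > 0` for all `δ ∈ D`, then there is a neighborhood
`U` of the origin such that system (1.9) has at most `k` limit cycles in `U`
for every `δ ∈ D`. -/
theorem focus_at_most_k_limit_cycles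
    (n mp : ℕ) (hn : 2 ≤ n)
    (D : Set (Fin mp → ℝ)) (hD : IsCompact D)
    (XX YY : ℝ → ℝ → (Fin mp → ℝ) → ℝ)
    (hXana : ∀ δ ∈ D, AnalyticAt ℝ
      (fun p : ℝ × ℝ × (Fin mp → ℝ) => XX p.1 p.2.1 p.2.2) (0, 0, δ))
    (hYana : ∀ δ ∈ D, AnalyticAt ℝ
      (fun p : ℝ × ℝ × (Fin mp → ℝ) => YY p.1 p.2.1 p.2.2) (0, 0, δ))
    (hXsmall : ∀ δ ∈ D,
      (fun p : ℝ × ℝ => XX p.1 p.2 δ) =O[nhds (0 : ℝ × ℝ)] fun p => ‖p‖ ^ 2)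
    (hYsmall : ∀ δ ∈ D,
      (fun p : ℝ × ℝ => YY p.1 p.2 δ) =O[nhds (0 : ℝ × ℝ)] fun p => ‖p‖ ^ 2)
    -- `y = F(x,δ)` is the analytic solution of `y + X(x,y,δ) = 0`, `F(0,δ) = 0`
    (F : ℝ → (Fin mp → ℝ) → ℝ)
    (hFana : ∀ δ ∈ D, AnalyticAt ℝ (fun x => F x δ) 0)
    (hF0 : ∀ δ ∈ D, F 0 δ = 0)
    (hFsol : ∀ δ ∈ D, ∀ᶠ x in nhds (0 : ℝ), F x δ + XX x (F x δ) δ = 0)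
    -- the functions (1.10)
    (g f : ℝ → (Fin mp → ℝ) → ℝ)
    (hgdef : ∀ δ ∈ D, ∀ x, g x δ = -YY x (F x δ) δ)
    (hfdef : ∀ δ ∈ D, ∀ x, f x δ =
      -(deriv (fun s => XX s (F x δ) δ) x + deriv (fun s => YY x s δ) (F x δ)))
    -- condition (1.11)
    (a : (Fin mp → ℝ) → ℝ) (ha : ∀ δ ∈ D, 0 < a δ)
    (hg11 : ∀ δ ∈ D, ∃ u : ℝ → ℝ, AnalyticAt ℝ u 0 ∧ u 0 = a δ ∧
      ∀ᶠ x in nhds (0 : ℝ), g x δ = x ^ (2 * n - 1) * u x)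
    -- condition (1.12)
    (b : (Fin mp → ℝ) → ℝ)
    (hf12 : ∀ δ ∈ D, ∃ w : ℝ → ℝ, AnalyticAt ℝ w 0 ∧ w 0 = b δ ∧
      ∀ᶠ x in nhds (0 : ℝ), f x δ = x ^ (n - 1) * w x)
    (hb : ∀ δ ∈ D, (b δ) ^ 2 - 4 * n * a δ < 0)
    -- the Poincaré return map
    (P : ℝ → (Fin mp → ℝ) → ℝ)
    (hP0 : ∀ δ ∈ D, P 0 δ = 0)
    (hP : ∀ δ ∈ D, ∃ ε > 0, ∀ x₀ : ℝ, x₀ ≠ 0 → |x₀| < ε →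
      ∃ γ : ℝ → ℝ × ℝ, γ 0 = (x₀, F x₀ δ) ∧
        (∀ t : ℝ,
          HasDerivAt (fun s => (γ s).1) ((γ t).2 + XX (γ t).1 (γ t).2 δ) t ∧
          HasDerivAt (fun s => (γ s).2) (YY (γ t).1 (γ t).2 δ) t) ∧
        ∃ τ : ℝ, 0 < τ ∧
          ((γ τ).2 = F (γ τ).1 δ ∧ 0 < x₀ * (γ τ).1) ∧
          (∀ t : ℝ, 0 < t → t < τ →
            ¬((γ t).2 = F (γ t).1 δ ∧ 0 < x₀ * (γ t).1)) ∧
          P x₀ δ = (γ τ).1)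
    -- the analytic extension `P̄` of `P` provided by Theorem 1.4
    (Pb : ℝ → (Fin mp → ℝ) → ℝ)
    (hPb : ∀ δ ∈ D, AnalyticAt ℝ (fun x₀ => Pb x₀ δ) 0 ∧ Pb 0 δ = 0 ∧
      0 < deriv (fun x₀ => Pb x₀ δ) 0 ∧
      (∀ᶠ x₀ in nhdsWithin (0 : ℝ) (Ioi 0), P x₀ δ = Pb x₀ δ))
    (hPbodd : Odd n → ∀ δ ∈ D, ∀ᶠ x₀ in nhds (0 : ℝ), P x₀ δ = Pb x₀ δ)
    (hPbeven : Even n → ∀ δ ∈ D,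
      ∀ᶠ x₀ in nhdsWithin (0 : ℝ) (Iio 0), Pb (P x₀ δ) δ = x₀)
    -- `P̄` is jointly analytic in `(x₀, δ)`
    (hPbjoint : ∀ δ ∈ D, AnalyticAt ℝ (fun p : ℝ × (Fin mp → ℝ) => Pb p.1 p.2) (0, δ))
    -- the coefficients `v_j(δ)` of `d̄(x₀,δ) = P̄(x₀,δ) - x₀ = Σ_{j≥1} v_j(δ)x₀^j`
    (v : ℕ → (Fin mp → ℝ) → ℝ)
    (hv : ∀ δ ∈ D, ∀ j : ℕ,
      iteratedDeriv j (fun x₀ => Pb x₀ δ - x₀) 0 = (j.factorial : ℝ) * v j δ)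
    (k : ℕ) (hk : 1 ≤ k)
    (hvne : ∀ δ ∈ D, ∃ j : ℕ, 1 ≤ j ∧ j ≤ k + 1 ∧ v (2 * j - 1 + pnVal n) δ ≠ 0) :
    ∃ U ∈ nhds (0 : ℝ × ℝ), ∀ δ ∈ D,
      {Γ : Set (ℝ × ℝ) | IsLimitCycle19 mp XX YY δ Γ ∧ Γ ⊆ U}.Finite ∧
      {Γ : Set (ℝ × ℝ) | IsLimitCycle19 mp XX YY δ Γ ∧ Γ ⊆ U}.ncard ≤ k := by
  have hX0 : ∀ δ ∈ D, XX 0 0 δ = 0 := fun δ hδ => by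
    exact Asymptotics.IsBigO.eq_zero_of_norm_pow (x₀ := (0 : ℝ × ℝ)) (n := 2)
      (by simpa using hXsmall δ hδ) two_ne_zero
  have hY0 : ∀ δ ∈ D, YY 0 0 δ = 0 := fun δ hδ => by
    exact Asymptotics.IsBigO.eq_zero_of_norm_pow (x₀ := (0 : ℝ × ℝ)) (n := 2)
      (by simpa using hYsmall δ hδ) two_ne_zero
  have h0 : ∀ δ ∈ D, planarField XX YY δ 0 = 0 := fun δ hδ => by
    simp [planarField, hX0 δ hδ, hY0 δ hδ]
  have hXy : ∀ δ ∈ D, HasDerivAt (fun y => XX 0 y δ) 0 0 := by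
    intro δ hδ
    have h1 : HasFDerivAt (fun p : ℝ × ℝ => XX p.1 p.2 δ) (0 : ℝ × ℝ →L[ℝ] ℝ) (0 : ℝ × ℝ) :=
      Asymptotics.IsBigO.hasFDerivAt (n := 2) (by simpa using hXsmall δ hδ) one_lt_two
    have h2 : HasDerivAt (fun y : ℝ => ((0 : ℝ), y)) ((0 : ℝ), (1 : ℝ)) 0 :=
      (hasDerivAt_const _ _).prodMk (hasDerivAt_id _)
    simpa [Function.comp_def] using
      HasFDerivAt.comp_hasDerivAt (f := fun y : ℝ => ((0 : ℝ), y)) (0 : ℝ) h1 h2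
  have hFc : ∀ δ ∈ D, ContinuousAt (fun x => F x δ) 0 := fun δ hδ => (hFana δ hδ).continuousAt
  have hloc : ∀ δ₀ ∈ D, ∃ V ∈ nhdsWithin δ₀ D, ∃ U ∈ nhds (0 : ℝ × ℝ), ∀ δ ∈ D ∩ V,
      ∀ S : Finset (Set (ℝ × ℝ)),
      (∀ Γ ∈ S, IsPeriodicOrbit19 mp XX YY δ Γ ∧ Γ ⊆ U) → S.card ≤ k := by
    intro δ₀ hδ₀
    obtain ⟨nf⟩ := exists_normalForm (n := n) (a := a) (b := b) hδ₀ (hXana δ₀ hδ₀) (hYana δ₀ hδ₀)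
      hX0 (hXy δ₀ hδ₀) F hFc hF0 hFsol
      (fun δ hδ => by
        obtain ⟨u, hu, hu0, he⟩ := hg11 δ hδ
        refine ⟨u, hu.continuousAt, hu0, ?_⟩
        simpa only [hgdef δ hδ] using he)
      (fun δ hδ => by
        obtain ⟨w, hw, hw0, he⟩ := hf12 δ hδ
        refine ⟨w, hw.continuousAt, hw0, ?_⟩
        simpa only [hfdef δ hδ] using he)
    obtain ⟨j, hj1, hjk, hvj⟩ := hvne δ₀ hδ₀
    obtain ⟨U, hU, V, hV, hUV⟩ := nf.exists_card_periodicOrbits_le hδ₀ hn (ha δ₀ hδ₀) (hb δ₀ hδ₀)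
      h0 hFc hF0 hFsol (P := P) (Pb := Pb)
      (fun δ hδ => by
        obtain ⟨ε, hε, h⟩ := hP δ hδ
        refine ⟨ε, hε, fun x₀ hx₀ hx₀' => ?_⟩
        obtain ⟨γ, hγ0, hγ, hτ⟩ := h x₀ hx₀ hx₀'
        exact ⟨γ, hγ0, fun t => (hγ t).1.prodMk (hγ t).2, hτ⟩)
      (fun δ hδ => (hPb δ hδ).2.2.2) (hPbjoint δ₀ hδ₀) (2 * j - 1 + pnVal n)
      (by
        rw [hv δ₀ hδ₀]
        exact mul_ne_zero (by positivity) hvj)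
    refine ⟨V, mem_nhdsWithin_of_mem_nhds hV, U, hU, fun δ hδ S hS => ?_⟩
    have h1 := hUV δ hδ S hS
    have h2 : pnVal n ≤ 1 := by
      unfold pnVal
      split_ifs <;> simp
    omega
  obtain ⟨U, hU, hUS⟩ := hD.induction_on
    (p := fun s => ∃ U ∈ nhds (0 : ℝ × ℝ), ∀ δ ∈ D ∩ s, ∀ S : Finset (Set (ℝ × ℝ)),
      (∀ Γ ∈ S, IsPeriodicOrbit19 mp XX YY δ Γ ∧ Γ ⊆ U) → S.card ≤ k)
    ⟨univ, univ_mem, fun δ hδ => absurd hδ.2 (notMem_empty δ)⟩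
    (fun s t hst ⟨U, hU, h⟩ => ⟨U, hU, fun δ hδ => h δ ⟨hδ.1, hst hδ.2⟩⟩)
    (fun s t ⟨U, hU, h⟩ ⟨U', hU', h'⟩ => ⟨U ∩ U', inter_mem hU hU', fun δ hδ S hS => by
      rcases hδ.2 with hs | ht
      · exact h δ ⟨hδ.1, hs⟩ S fun Γ hΓ => ⟨(hS Γ hΓ).1, (hS Γ hΓ).2.trans inter_subset_left⟩
      · exact h' δ ⟨hδ.1, ht⟩ S fun Γ hΓ => ⟨(hS Γ hΓ).1, (hS Γ hΓ).2.trans inter_subset_right⟩⟩)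
    hloc
  exact ⟨U, hU, fun δ hδ => Set.finite_and_ncard_le_of_forall_finset_card_le fun S hS =>
    hUS δ ⟨hδ, hδ⟩ S fun Γ hΓ => ⟨(hS hΓ).1.1, (hS hΓ).2⟩⟩
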